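/- arXiv:1501.07626 — 4 statements merged into one kernel-verified Lean document; each statement's English description precedes it below -/
import Mathlib

section
/- Let 𝒫 be a nested partition of the unit circle S¹ with at least two parts. Then: (1) for every part P ∈ 𝒫, every connected component of S¹ \ P contains a singular part of 𝒫; (2) for every finite collection P₁, …, P_m of pairwise distinct parts of 𝒫, each having finitely many connected components with rank(P_j) ≥ 3, the cardinality of the set of singular parts of 𝒫 is at least Σ_{j=1}^{m} (rank(P_j) − 2) + 2 (in particular, the number of singular parts is at least the triangularity of 𝒫 plus 2). -/
open Set

noncomputable section

/-- The unit circle `S¹ ⊆ ℝ²`. -/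
def S1 : Set (ℝ × ℝ) := {x | x.1 ^ 2 + x.2 ^ 2 = 1}

/-- `P` is a partition of `S¹`: nonempty pairwise disjoint subsets covering `S¹`. -/
def IsPartitionOfS1 (P : Set (Set (ℝ × ℝ))) : Prop :=
  (∀ A ∈ P, A.Nonempty ∧ A ⊆ S1) ∧
  (∀ A ∈ P, ∀ B ∈ P, A ≠ B → A ∩ B = ∅) ∧
  ⋃₀ P = S1

/-- `P` is nested: for every part `A` and every point `p ∉ A`, the part of `p`
lies in a single connected component of `S¹ \ A`. -/
def IsNestedPartition (P : Set (Set (ℝ × ℝ))) : Prop :=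
  ∀ A ∈ P, ∀ B ∈ P, ∀ p ∈ B, p ∉ A →
    B ⊆ connectedComponentIn (S1 \ A) p

/-- The set of connected components of a set `A`. -/
def componentsOf {X : Type*} [TopologicalSpace X] (A : Set X) : Set (Set X) :=
  {T | ∃ p ∈ A, T = connectedComponentIn A p}

/-- The standard parametrization of the circle by angles. -/
def circlePt (t : ℝ) : ℝ × ℝ := (Real.cos t, Real.sin t)

lemma circlePt_mem (t : ℝ) : circlePt t ∈ S1 := Real.cos_sq_add_sin_sq t

lemma continuous_circlePt : Continuous circlePt :=
  Real.continuous_cos.prodMk Real.continuous_sin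

lemma circlePt_add_two_pi (t : ℝ) : circlePt (t + 2 * Real.pi) = circlePt t := by
  simp [circlePt]

lemma exists_circlePt_eq {p : ℝ × ℝ} (hp : p ∈ S1) (α : ℝ) :
    ∃ t ∈ Ico α (α + 2 * Real.pi), circlePt t = p := by
  obtain ⟨a, b⟩ := p
  have hab : a ^ 2 + b ^ 2 = 1 := hp
  have hn : ‖(⟨a, b⟩ : ℂ)‖ = 1 := by
    rw [Complex.norm_def, Complex.normSq_mk, ← sq, ← sq, hab, Real.sqrt_one]
  have h0 : (⟨a, b⟩ : ℂ) ≠ 0 := by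
    intro h
    rw [h, norm_zero] at hn
    exact zero_ne_one hn
  refine ⟨toIcoMod Real.two_pi_pos α (Complex.arg ⟨a, b⟩), toIcoMod_mem_Ico _ _ _, ?_⟩
  have h1 := Complex.cos_arg h0
  have h2 := Complex.sin_arg ⟨a, b⟩
  rw [hn] at h1 h2
  simp only [div_one] at h1 h2
  rw [circlePt, toIcoMod, zsmul_eq_mul, Real.cos_sub_int_mul_two_pi, Real.sin_sub_int_mul_two_pi,
    h1, h2]

/-- Removing two points of the circle separates the two open arcs between them. -/
lemma IsPreconnected.circlePt_notMem {D : Set (ℝ × ℝ)} (hD : IsPreconnected D) (hS : D ⊆ S1)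
    {u x v y : ℝ} (hux : u < x) (hxv : x < v) (hvy : v < y) (hyu : y < u + 2 * Real.pi)
    (hu : circlePt u ∉ D) (hv : circlePt v ∉ D) (hx : circlePt x ∈ D) : circlePt y ∉ D := by
  intro hy
  let F : ℝ × ℝ → ℝ := fun z =>
    z.1 * Real.cos ((u + v) / 2) + z.2 * Real.sin ((u + v) / 2) - Real.cos ((v - u) / 2)
  have hF : ∀ t, F (circlePt t) = -2 * Real.sin ((t - u) / 2) * Real.sin ((t - v) / 2) := by
    intro t
    have h := Real.cos_sub_cos (t - (u + v) / 2) ((v - u) / 2)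
    rw [Real.cos_sub] at h
    simp only [F, circlePt]
    rw [h]
    ring_nf
  have hFc : ContinuousOn F D := by fun_prop
  have hpx : 0 ≤ F (circlePt x) := by
    rw [hF]
    have h1 : 0 < Real.sin ((x - u) / 2) :=
      Real.sin_pos_of_pos_of_lt_pi (by linarith) (by linarith)
    have h2 : Real.sin ((x - v) / 2) < 0 :=
      Real.sin_neg_of_neg_of_neg_pi_lt (by linarith) (by linarith)
    nlinarith
  have hpy : F (circlePt y) ≤ 0 := by
    rw [hF]
    have h1 : 0 < Real.sin ((y - u) / 2) :=
      Real.sin_pos_of_pos_of_lt_pi (by linarith) (by linarith)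
    have h2 : 0 < Real.sin ((y - v) / 2) :=
      Real.sin_pos_of_pos_of_lt_pi (by linarith) (by linarith)
    nlinarith
  obtain ⟨z, hzD, hz⟩ := hD.intermediate_value hy hx hFc ⟨hpy, hpx⟩
  obtain ⟨t, ht, rfl⟩ := exists_circlePt_eq (hS hzD) u
  have htu : t ≠ u := by rintro rfl; exact hu hzD
  have htv : t ≠ v := by rintro rfl; exact hv hzD
  have h1 : 0 < Real.sin ((t - u) / 2) :=
    Real.sin_pos_of_pos_of_lt_pi (by linarith [lt_of_le_of_ne ht.1 htu.symm]) (by linarith [ht.2])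
  rw [hF] at hz
  rcases lt_or_gt_of_ne htv with h | h
  · have h2 : Real.sin ((t - v) / 2) < 0 :=
      Real.sin_neg_of_neg_of_neg_pi_lt (by linarith) (by linarith [ht.1])
    nlinarith
  · have h2 : 0 < Real.sin ((t - v) / 2) :=
      Real.sin_pos_of_pos_of_lt_pi (by linarith) (by linarith [ht.2])
    nlinarith

lemma connectedComponentIn_circlePt_eq {D : Set (ℝ × ℝ)} {s t : ℝ}
    (h : ∀ r ∈ uIcc s t, circlePt r ∈ D) :
    connectedComponentIn D (circlePt s) = connectedComponentIn D (circlePt t) := by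
  apply connectedComponentIn_eq
  have hc : IsPreconnected (circlePt '' uIcc s t) :=
    isPreconnected_uIcc.image _ continuous_circlePt.continuousOn
  exact hc.subset_connectedComponentIn (mem_image_of_mem _ left_mem_uIcc)
    (image_subset_iff.2 h) (mem_image_of_mem _ right_mem_uIcc)

section Labelling

variable {ι : Type*}

/-- A labelling `f` is noncrossing on `[b₀, b₁]` if no two distinct labels alternate there. -/
def NoncrossingOn (f : ℝ → ι) (b₀ b₁ : ℝ) : Prop :=
  ∀ x y z w, b₀ ≤ x → x < y → y < z → z < w → w ≤ b₁ → f x = f z → f y = f w → f x = f y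

lemma NoncrossingOn.mem_Ioo_and_ne {f : ℝ → ι} {b₀ b₁ b b' m y t : ℝ}
    (hf : NoncrossingOn f b₀ b₁) (h0 : b₀ ≤ b) (h1 : b' ≤ b₁) (hbb : f b = f b')
    (hbm : b < m) (hmb : m < b') (hm : f m ≠ f b) (hy : y ∈ Icc b₀ b₁) (hym : f y = f m)
    (ht : t ∈ uIcc m y) : y ∈ Ioo b b' ∧ f t ≠ f b := by
  have hyb : y ≠ b := by rintro rfl; exact hm hym.symm
  have hyb' : y ≠ b' := by rintro rfl; exact hm (hym.symm.trans hbb.symm)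
  have h2 : b < y := by
    by_contra h
    exact hm (hym.symm.trans (hf y b m b' hy.1 (lt_of_le_of_ne (not_lt.1 h) hyb) hbm hmb h1 hym hbb))
  have h3 : y < b' := by
    by_contra h
    exact hm (hf b m b' y h0 hbm hmb (lt_of_le_of_ne (not_lt.1 h) hyb'.symm) hy.2 hbb hym.symm).symm
  refine ⟨⟨h2, h3⟩, fun htb => ?_⟩
  have htm : t ≠ m := by rintro rfl; exact hm htb
  have hty : t ≠ y := by rintro rfl; exact hm (hym.symm.trans htb)
  rcases le_total m y with h | h
  · rw [uIcc_of_le h] at ht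
    exact hm (hf b m t y h0 hbm (lt_of_le_of_ne ht.1 htm.symm) (lt_of_le_of_ne ht.2 hty) hy.2
      htb.symm hym.symm).symm
  · rw [uIcc_of_ge h] at ht
    exact hm (hym.symm.trans ((hf y t m b' hy.1 (lt_of_le_of_ne ht.1 hty.symm)
      (lt_of_le_of_ne ht.2 htm) hmb h1 hym (htb.trans hbb)).trans htb))

/-- A gap of a class contains a convex class or a pair of points of another class which
bounds a gap at most half as long. -/
lemma NoncrossingOn.exists_ordConnected_or_gap {f : ℝ → ι} {b₀ b₁ b b' c : ℝ}
    (hf : NoncrossingOn f b₀ b₁) (h0 : b₀ ≤ b) (h1 : b' ≤ b₁) (hbb : f b = f b')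
    (hbc : b < c) (hcb : c < b') (hc : f c ≠ f b) :
    (∃ x ∈ Ioo b b', (∀ t ∈ uIcc c x, f t ≠ f b) ∧
      OrdConnected {t | t ∈ Icc b₀ b₁ ∧ f t = f x}) ∨
    ∃ d d' e, b < d ∧ d < e ∧ e < d' ∧ d' < b' ∧ f d = f d' ∧ f e ≠ f d ∧
      d' - d ≤ (b' - b) / 2 ∧ ∀ x ∈ Icc d d', ∀ t ∈ uIcc c x, f t ≠ f b := by
  let G : Set ℝ := {x | x ∈ Ioo b b' ∧ ∀ t ∈ uIcc c x, f t ≠ f b}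
  have hcG : c ∈ G := by
    refine ⟨⟨hbc, hcb⟩, fun t ht => ?_⟩
    rw [uIcc_self] at ht
    rw [show t = c from ht]
    exact hc
  have hG : ∀ x ∈ G, ∀ y ∈ G, ∀ t, x ≤ t → t ≤ y → t ∈ G := by
    intro x hx y hy t hxt hty
    refine ⟨⟨hx.1.1.trans_le hxt, hty.trans_lt hy.1.2⟩, fun s hs => ?_⟩
    rcases le_total c t with h | h
    · rw [uIcc_of_le h] at hs
      exact hy.2 s (by rw [uIcc_of_le (h.trans hty)]; exact ⟨hs.1, hs.2.trans hty⟩)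
    · rw [uIcc_of_ge h] at hs
      exact hx.2 s (by rw [uIcc_of_ge (hxt.trans h)]; exact ⟨hxt.trans hs.1, hs.2⟩)
  obtain ⟨m, hm, hlen⟩ : ∃ m ∈ G, ∀ x ∈ G, |x - m| ≤ (b' - b) / 2 := by
    by_cases hμ : (b + b') / 2 ∈ G
    · refine ⟨_, hμ, fun x hx => ?_⟩
      rw [abs_le]
      constructor <;> linarith [hx.1.1, hx.1.2]
    · refine ⟨c, hcG, fun x hx => ?_⟩
      rw [abs_le]
      rcases le_total c ((b + b') / 2) with h | h
      · have : x < (b + b') / 2 := by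
          by_contra h'
          exact hμ (hG c hcG x hx _ h (not_lt.1 h'))
        constructor <;> linarith [hx.1.1]
      · have : (b + b') / 2 < x := by
          by_contra h'
          exact hμ (hG x hx c hcG _ (not_lt.1 h') h)
        constructor <;> linarith [hx.1.2]
  have hmb : f m ≠ f b := hm.2 m right_mem_uIcc
  have hclass : ∀ y ∈ Icc b₀ b₁, f y = f m → y ∈ G := by
    intro y hy hym
    refine ⟨(hf.mem_Ioo_and_ne h0 h1 hbb hm.1.1 hm.1.2 hmb hy hym left_mem_uIcc).1, fun t ht => ?_⟩
    rcases uIcc_subset_uIcc_union_uIcc (b := m) ht with h | h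
    · exact hm.2 t h
    · exact (hf.mem_Ioo_and_ne h0 h1 hbb hm.1.1 hm.1.2 hmb hy hym h).2
  have hm0 : m ∈ Icc b₀ b₁ := ⟨h0.trans hm.1.1.le, hm.1.2.le.trans h1⟩
  by_cases hord : OrdConnected {t | t ∈ Icc b₀ b₁ ∧ f t = f m}
  · exact Or.inl ⟨m, hm.1, hm.2, hord⟩
  · right
    rw [ordConnected_iff] at hord
    push Not at hord
    obtain ⟨y, hy, w, hw, -, hyw⟩ := hord
    obtain ⟨z, hz, hz'⟩ := not_subset.1 hyw
    have hz0 : z ∈ Icc b₀ b₁ := ⟨hy.1.1.trans hz.1, hz.2.trans hw.1.2⟩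
    have hzm : f z ≠ f m := fun h => hz' ⟨hz0, h⟩
    have hyz : y < z := lt_of_le_of_ne hz.1 (by rintro rfl; exact hzm hy.2)
    have hzw : z < w := lt_of_le_of_ne hz.2 (by rintro rfl; exact hzm hw.2)
    have hyG := hclass y hy.1 hy.2
    have hwG := hclass w hw.1 hw.2
    rcases lt_or_gt_of_ne (show z ≠ m by rintro rfl; exact hzm rfl) with h | h
    · refine ⟨y, m, z, hyG.1.1, hyz, h, hm.1.2, hy.2, by rwa [hy.2], ?_, fun x hx =>
        (hG y hyG m hm x hx.1 hx.2).2⟩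
      linarith [(abs_le.1 (hlen y hyG)).1]
    · refine ⟨m, w, z, hm.1.1, h, hzw, hwG.1.2, hw.2.symm, hzm, ?_, fun x hx =>
        (hG m hm w hwG x hx.1 hx.2).2⟩
      linarith [(abs_le.1 (hlen w hwG)).2]

lemma NoncrossingOn.exists_ordConnected_mem_Icc {f : ℝ → ι} {b₀ b₁ b b' c : ℝ}
    (hf : NoncrossingOn f b₀ b₁) (h0 : b₀ ≤ b) (h1 : b' ≤ b₁) (hbb : f b = f b')
    (hbc : b < c) (hcb : c < b') (hc : f c ≠ f b) :
    ∃ x ∈ Icc b b', OrdConnected {t | t ∈ Icc b₀ b₁ ∧ f t = f x} := by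
  by_contra hno
  push Not at hno
  let S := {s : ℝ × ℝ // b ≤ s.1 ∧ s.2 ≤ b' ∧ f s.1 = f s.2 ∧
    ∃ e, s.1 < e ∧ e < s.2 ∧ f e ≠ f s.1}
  have step : ∀ s : S, ∃ r : S, s.1.1 < r.1.1 ∧ r.1.2 < s.1.2 ∧
      r.1.2 - r.1.1 ≤ (s.1.2 - s.1.1) / 2 ∧ ∀ x ∈ Icc r.1.1 r.1.2, f x ≠ f s.1.1 := by
    rintro ⟨⟨d, d'⟩, hd, hd', hdd, e, hde, hed, he⟩
    rcases hf.exists_ordConnected_or_gap (h0.trans hd) (hd'.trans h1) hdd hde hed he with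
      ⟨x, hx, -, hx'⟩ | ⟨u, u', v, h2, h3, h4, h5, h6, h7, h8, h9⟩
    · exact (hno x ⟨hd.trans hx.1.le, hx.2.le.trans hd'⟩ hx').elim
    · exact ⟨⟨(u, u'), hd.trans h2.le, h5.le.trans hd', h6, v, h3, h4, h7⟩, h2, h5, h8,
        fun x hx => h9 x hx x right_mem_uIcc⟩
  choose next hn1 hn2 hn3 hn4 using step
  let s : ℕ → S := fun n => Nat.rec ⟨(b, b'), le_rfl, le_rfl, hbb, c, hbc, hcb, hc⟩
    (fun _ r => next r) n
  have hs : ∀ n, s (n + 1) = next (s n) := fun n => rfl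
  have hlt : ∀ n, (s n).1.1 < (s n).1.2 := fun n => by
    obtain ⟨e, h, h', -⟩ := (s n).2.2.2.2
    exact h.trans h'
  have hmono : Monotone fun n => (s n).1.1 :=
    monotone_nat_of_le_succ fun n => by rw [hs]; exact (hn1 _).le
  have hanti : Antitone fun n => (s n).1.2 :=
    antitone_nat_of_succ_le fun n => by rw [hs]; exact (hn2 _).le
  have hle : ∀ n k, (s n).1.1 ≤ (s k).1.2 := fun n k =>
    (hmono (le_max_left n k)).trans ((hlt _).le.trans (hanti (le_max_right n k)))
  set x := ⨆ n, (s n).1.1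
  have hx1 : ∀ n, (s n).1.1 ≤ x := fun n =>
    le_ciSup ⟨(s 0).1.2, by rintro _ ⟨k, rfl⟩; exact hle k 0⟩ n
  have hx2 : ∀ n, x ≤ (s n).1.2 := fun n => ciSup_le fun k => hle k n
  have hlen : ∀ n, (s n).1.2 - (s n).1.1 ≤ (b' - b) * (1 / 2) ^ n := by
    intro n
    induction n with
    | zero => simp [s]
    | succ k ih =>
      rw [hs, pow_succ]
      linarith [hn3 (s k)]
  have hxs : ∀ n, (s n).1.1 < x ∧ x < (s n).1.2 ∧ f x ≠ f (s n).1.1 := by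
    intro n
    have h1 := hx1 (n + 1)
    have h2 := hx2 (n + 1)
    have h3 := hn4 (s n) x
    rw [hs] at h1 h2
    exact ⟨(hn1 _).trans_le h1, h2.trans_lt (hn2 _), h3 ⟨h1, h2⟩⟩
  refine hno x ⟨hx1 0, hx2 0⟩ ?_
  have hsing : {t | t ∈ Icc b₀ b₁ ∧ f t = f x} ⊆ {x} := by
    rintro y ⟨hy, hyx⟩
    have hy' : ∀ n, |y - x| ≤ (b' - b) * (1 / 2) ^ n := by
      intro n
      have h := (hf.mem_Ioo_and_ne (h0.trans (s n).2.1) ((s n).2.2.1.trans h1) (s n).2.2.2.1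
        (hxs n).1 (hxs n).2.1 (hxs n).2.2 hy hyx left_mem_uIcc).1
      rw [abs_le]
      constructor <;> linarith [hlen n, hx1 n, hx2 n, h.1, h.2]
    have hlim : Filter.Tendsto (fun n : ℕ => (b' - b) * (1 / 2) ^ n) Filter.atTop (nhds 0) := by
      have := (tendsto_pow_atTop_nhds_zero_of_lt_one (r := (1 / 2 : ℝ)) (by norm_num)
        (by norm_num)).const_mul (b' - b)
      rwa [mul_zero] at this
    have := ge_of_tendsto' hlim hy'
    exact sub_eq_zero.1 (abs_nonpos_iff.1 this)
  exact (subsingleton_singleton.anti hsing).isPreconnected.ordConnected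

lemma NoncrossingOn.exists_ordConnected {f : ℝ → ι} {b b' c : ℝ}
    (hf : NoncrossingOn f b b') (hbb : f b = f b') (hbc : b < c) (hcb : c < b') (hc : f c ≠ f b) :
    ∃ x, (∀ t ∈ uIcc c x, f t ≠ f b) ∧ OrdConnected {t | t ∈ Icc b b' ∧ f t = f x} := by
  rcases hf.exists_ordConnected_or_gap le_rfl le_rfl hbb hbc hcb hc with
    ⟨x, -, hx, hx'⟩ | ⟨d, d', e, h2, h3, h4, h5, h6, h7, -, h9⟩
  · exact ⟨x, hx, hx'⟩
  · obtain ⟨x, hx, hx'⟩ := hf.exists_ordConnected_mem_Icc h2.le h5.le h6 h3 h4 h7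
    exact ⟨x, h9 x hx, hx'⟩

end Labelling

/-- The part of `P` containing the point at angle `t`. -/
def partAt (P : Set (Set (ℝ × ℝ))) (t : ℝ) : Set (ℝ × ℝ) := ⋃₀ {A ∈ P | circlePt t ∈ A}

section Partition

variable {P : Set (Set (ℝ × ℝ))}

lemma IsPartitionOfS1.eq_of_mem (hP : IsPartitionOfS1 P) {A B : Set (ℝ × ℝ)} (hA : A ∈ P)
    (hB : B ∈ P) {q : ℝ × ℝ} (hqA : q ∈ A) (hqB : q ∈ B) : A = B := by
  by_contra h
  have : q ∈ A ∩ B := ⟨hqA, hqB⟩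
  rw [hP.2.1 A hA B hB h] at this
  exact this

lemma IsPartitionOfS1.partAt_eq_iff (hP : IsPartitionOfS1 P) {A : Set (ℝ × ℝ)} (hA : A ∈ P)
    {t : ℝ} : partAt P t = A ↔ circlePt t ∈ A := by
  have key : ∀ B ∈ P, circlePt t ∈ B → partAt P t = B := by
    intro B hB ht
    apply Subset.antisymm
    · rintro q ⟨C, ⟨hC, hC'⟩, hq⟩
      rwa [← hP.eq_of_mem hC hB hC' ht]
    · exact subset_sUnion_of_mem (show B ∈ {A ∈ P | circlePt t ∈ A} from ⟨hB, ht⟩)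
  refine ⟨?_, key A hA⟩
  rintro rfl
  obtain ⟨B, hB, hB'⟩ : circlePt t ∈ ⋃₀ P := hP.2.2 ▸ circlePt_mem t
  rwa [key B hB hB']

lemma IsPartitionOfS1.partAt_mem (hP : IsPartitionOfS1 P) (t : ℝ) : partAt P t ∈ P := by
  obtain ⟨B, hB, hB'⟩ : circlePt t ∈ ⋃₀ P := hP.2.2 ▸ circlePt_mem t
  rwa [(hP.partAt_eq_iff hB).2 hB']

lemma IsPartitionOfS1.circlePt_mem_partAt (hP : IsPartitionOfS1 P) (t : ℝ) :
    circlePt t ∈ partAt P t := (hP.partAt_eq_iff (hP.partAt_mem t)).1 rfl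

lemma IsNestedPartition.partAt_eq (hP : IsPartitionOfS1 P) (hn : IsNestedPartition P)
    {x y z w : ℝ} (hxy : x < y) (hyz : y < z) (hzw : z < w) (hwx : w < x + 2 * Real.pi)
    (hxz : partAt P x = partAt P z) (hyw : partAt P y = partAt P w) :
    partAt P x = partAt P y := by
  by_contra hne
  have hy : circlePt y ∉ partAt P x := fun h =>
    hne ((hP.partAt_eq_iff (hP.partAt_mem x)).2 h).symm
  have hsub := hn _ (hP.partAt_mem x) _ (hP.partAt_mem y) _ (hP.circlePt_mem_partAt y) hy
  have hD := connectedComponentIn_subset (S1 \ partAt P x) (circlePt y)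
  refine isPreconnected_connectedComponentIn.circlePt_notMem (hD.trans sdiff_subset)
    hxy hyz hzw hwx (fun h => (hD h).2 (hP.circlePt_mem_partAt x))
    (fun h => (hD h).2 (hxz ▸ hP.circlePt_mem_partAt z)) (hsub (hP.circlePt_mem_partAt y))
    (hsub (hyw ▸ hP.circlePt_mem_partAt w))

lemma partAt_add_two_pi (t : ℝ) : partAt P (t + 2 * Real.pi) = partAt P t := by
  simp only [partAt, circlePt_add_two_pi]

lemma IsNestedPartition.noncrossingOn (hP : IsPartitionOfS1 P) (hn : IsNestedPartition P)
    (α : ℝ) : NoncrossingOn (partAt P) α (α + 2 * Real.pi) := by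
  intro x y z w hx hxy hyz hzw hw hxz hyw
  rcases (show w ≤ x + 2 * Real.pi by linarith).lt_or_eq with h | h
  · exact hn.partAt_eq hP hxy hyz hzw h hxz hyw
  · rw [hyw, h, partAt_add_two_pi]

lemma exists_circlePt_eq_of_ne {α : ℝ} {p : ℝ × ℝ} (hp : p ∈ S1) (hα : p ≠ circlePt α) :
    ∃ c, α < c ∧ c < α + 2 * Real.pi ∧ circlePt c = p := by
  obtain ⟨c, hc, rfl⟩ := exists_circlePt_eq hp α
  exact ⟨c, lt_of_le_of_ne hc.1 (by rintro rfl; exact hα rfl), hc.2, rfl⟩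

/-- Every component of the complement of a part contains a connected part. -/
lemma IsNestedPartition.exists_isConnected (hP : IsPartitionOfS1 P) (hn : IsNestedPartition P)
    {A : Set (ℝ × ℝ)} (hA : A ∈ P) {p : ℝ × ℝ} (hp : p ∈ S1 \ A) :
    ∃ B ∈ P, IsConnected B ∧ B ⊆ connectedComponentIn (S1 \ A) p := by
  obtain ⟨a, ha⟩ := (hP.1 A hA).1
  obtain ⟨α, -, rfl⟩ := exists_circlePt_eq ((hP.1 A hA).2 ha) 0
  obtain ⟨c, hc1, hc2, rfl⟩ := exists_circlePt_eq_of_ne (α := α) hp.1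
    (by rintro rfl; exact hp.2 ha)
  have hαA := (hP.partAt_eq_iff hA).2 ha
  obtain ⟨x, hx, hord⟩ := (hn.noncrossingOn hP α).exists_ordConnected
    (partAt_add_two_pi α).symm hc1 hc2
    (by rw [hαA]; exact fun h => hp.2 ((hP.partAt_eq_iff hA).1 h))
  rw [hαA] at hx
  have hx' : ∀ t ∈ uIcc c x, circlePt t ∈ S1 \ A := fun t ht =>
    ⟨circlePt_mem t, fun h => hx t ht ((hP.partAt_eq_iff hA).2 h)⟩
  refine ⟨partAt P x, hP.partAt_mem x, ⟨⟨_, hP.circlePt_mem_partAt x⟩, ?_⟩, ?_⟩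
  · have him : partAt P x =
        circlePt '' {t | t ∈ Icc α (α + 2 * Real.pi) ∧ partAt P t = partAt P x} := by
      apply Subset.antisymm
      · intro q hq
        obtain ⟨t, ht, rfl⟩ := exists_circlePt_eq ((hP.1 _ (hP.partAt_mem x)).2 hq) α
        exact ⟨t, ⟨Ico_subset_Icc_self ht, (hP.partAt_eq_iff (hP.partAt_mem x)).2 hq⟩, rfl⟩
      · rintro _ ⟨t, ht, rfl⟩
        exact (hP.partAt_eq_iff (hP.partAt_mem x)).1 ht.2
    rw [him]
    exact hord.isPreconnected.image _ continuous_circlePt.continuousOn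
  · rw [connectedComponentIn_circlePt_eq hx']
    exact hn A hA _ (hP.partAt_mem x) _ (hP.circlePt_mem_partAt x) (hx' x right_mem_uIcc).2

/-- The component of the complement of `A` which contains `X`, for nonempty `X`. -/
def gapOf (A X : Set (ℝ × ℝ)) : Set (ℝ × ℝ) := ⋃ p ∈ X, connectedComponentIn (S1 \ A) p

lemma IsNestedPartition.gapOf_eq (hP : IsPartitionOfS1 P) (hn : IsNestedPartition P)
    {A X : Set (ℝ × ℝ)} (hA : A ∈ P) (hX : X ∈ P) (hne : X ≠ A) {p : ℝ × ℝ} (hp : p ∈ X) :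
    gapOf A X = connectedComponentIn (S1 \ A) p := by
  have hpA : p ∉ A := fun h => hne (hP.eq_of_mem hX hA hp h)
  apply Subset.antisymm
  · refine iUnion₂_subset fun q hq => ?_
    rw [connectedComponentIn_eq (hn A hA X hX p hp hpA hq)]
  · exact subset_iUnion₂ (s := fun q (_ : q ∈ X) => connectedComponentIn (S1 \ A) q) p hp

lemma IsNestedPartition.gapOf_eq_gapOf (hP : IsPartitionOfS1 P) (hn : IsNestedPartition P)
    {A B X : Set (ℝ × ℝ)} (hA : A ∈ P) (hB : B ∈ P) (hX : X ∈ P) (hAB : A ≠ B) (hXA : X ≠ A)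
    (hXB : X ≠ B) (h : gapOf A X ≠ gapOf A B) : gapOf B X = gapOf B A := by
  obtain ⟨x, hx⟩ := (hP.1 X hX).1
  obtain ⟨ξ, -, rfl⟩ := exists_circlePt_eq ((hP.1 X hX).2 hx) 0
  obtain ⟨b, hb⟩ := (hP.1 B hB).1
  obtain ⟨β, hβ1, hβ2, rfl⟩ := exists_circlePt_eq_of_ne (α := ξ) ((hP.1 B hB).2 hb)
    (by rintro h; exact hXB (hP.eq_of_mem hX hB hx (h ▸ hb)))
  rw [hn.gapOf_eq hP hA hX hXA hx, hn.gapOf_eq hP hA hB hAB.symm hb] at h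
  have hβA : circlePt β ∉ A := fun h' => hAB (hP.eq_of_mem hA hB h' hb)
  have hξA : circlePt ξ ∉ A := fun h' => hXA (hP.eq_of_mem hX hA hx h')
  obtain ⟨s, hs1, hs2, hs⟩ : ∃ s, ξ < s ∧ s < β ∧ circlePt s ∈ A := by
    by_contra hno
    push Not at hno
    refine h (connectedComponentIn_circlePt_eq fun r hr => ⟨circlePt_mem r, fun hrA => ?_⟩)
    rw [uIcc_of_le hβ1.le] at hr
    exact hno r (lt_of_le_of_ne hr.1 (by rintro rfl; exact hξA hrA))
      (lt_of_le_of_ne hr.2 (by rintro rfl; exact hβA hrA)) hrA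
  obtain ⟨t, ht1, ht2, ht⟩ : ∃ t, β < t ∧ t < ξ + 2 * Real.pi ∧ circlePt t ∈ A := by
    by_contra hno
    push Not at hno
    rw [← circlePt_add_two_pi ξ] at h
    refine h (connectedComponentIn_circlePt_eq fun r hr => ⟨circlePt_mem r, fun hrA => ?_⟩)
    rw [uIcc_of_ge hβ2.le] at hr
    exact hno r (lt_of_le_of_ne hr.1 (by rintro rfl; exact hβA hrA))
      (lt_of_le_of_ne hr.2 (by rintro rfl; exact hξA (circlePt_add_two_pi ξ ▸ hrA))) hrA
  rw [hn.gapOf_eq hP hB hX hXB hx, hn.gapOf_eq hP hB hA hAB hs]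
  refine connectedComponentIn_circlePt_eq fun r hr => ⟨circlePt_mem r, fun hrB => ?_⟩
  rw [uIcc_of_le hs1.le] at hr
  have hrs : r < s := lt_of_le_of_ne hr.2 (by rintro rfl; exact hAB (hP.eq_of_mem hA hB hs hrB))
  have e1 := (hP.partAt_eq_iff hB).2 hrB
  have e2 := (hP.partAt_eq_iff hA).2 hs
  have e3 := (hP.partAt_eq_iff hB).2 hb
  have e4 := (hP.partAt_eq_iff hA).2 ht
  have := hn.partAt_eq hP hrs hs2 ht1 (by linarith [hr.1]) (e1.trans e3.symm) (e2.trans e4.symm)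
  exact hAB (by rw [← e1, ← e2, this])

end Partition

/-- A proper subset of the circle with `n` components has at least `n` components in its
complement. -/
lemma exists_gap_points {A : Set (ℝ × ℝ)} (hA : A ⊆ S1) (hne : (S1 \ A).Nonempty) {n : ℕ}
    (hcard : (componentsOf A).ncard = n) (hn : 2 ≤ n) :
    ∃ g : Fin n → ℝ × ℝ, (∀ i, g i ∈ S1 \ A) ∧
      ∀ i j, i < j →
        connectedComponentIn (S1 \ A) (g i) ≠ connectedComponentIn (S1 \ A) (g j) := by
  obtain ⟨p, hp⟩ := hne
  obtain ⟨α, -, rfl⟩ := exists_circlePt_eq hp.1 0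
  have hfin : (componentsOf A).Finite := Set.finite_of_ncard_pos (by omega)
  have hrep : ∀ T : componentsOf A, ∃ q, α < q ∧ q < α + 2 * Real.pi ∧ circlePt q ∈ A ∧
      T.1 = connectedComponentIn A (circlePt q) := by
    rintro ⟨T, q, hq, rfl⟩
    obtain ⟨c, h1, h2, rfl⟩ := exists_circlePt_eq_of_ne (α := α) (hA hq)
      (by rintro rfl; exact hp.2 hq)
    exact ⟨c, h1, h2, hq, rfl⟩
  choose rep hr1 hr2 hr3 hr4 using hrep
  have hinj : Function.Injective rep := fun S T h => Subtype.ext (by rw [hr4 S, hr4 T, h])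
  have := hfin.fintype
  have hc : (Finset.univ.image rep).card = n := by
    rw [Finset.card_image_of_injective _ hinj, Finset.card_univ, ← hcard,
      ← Nat.card_coe_set_eq, Nat.card_eq_fintype_card]
  let q := (Finset.univ.image rep).orderEmbOfFin hc
  have hq : ∀ i, ∃ T, rep T = q i := fun i => by
    obtain ⟨T, -, hT⟩ := Finset.mem_image.1 (Finset.orderEmbOfFin_mem (Finset.univ.image rep) hc i)
    exact ⟨T, hT⟩
  have hq1 : ∀ i, α < q i := fun i => by obtain ⟨T, hT⟩ := hq i; rw [← hT]; exact hr1 T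
  have hq2 : ∀ i, q i < α + 2 * Real.pi := fun i => by
    obtain ⟨T, hT⟩ := hq i; rw [← hT]; exact hr2 T
  have hq3 : ∀ i, circlePt (q i) ∈ A := fun i => by
    obtain ⟨T, hT⟩ := hq i; rw [← hT]; exact hr3 T
  have hq4 : ∀ i j, i < j → ∃ g, q i < g ∧ g < q j ∧ circlePt g ∉ A := by
    intro i j hij
    have hlt : q i < q j := q.strictMono hij
    by_contra hno
    push Not at hno
    have heq : connectedComponentIn A (circlePt (q i)) = connectedComponentIn A (circlePt (q j)) := by
      refine connectedComponentIn_circlePt_eq fun r hr => ?_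
      rw [uIcc_of_le hlt.le] at hr
      rcases hr.1.eq_or_lt with h | h
      · rw [← h]; exact hq3 i
      rcases hr.2.eq_or_lt with h' | h'
      · rw [h']; exact hq3 j
      exact hno r h h'
    obtain ⟨S, hS⟩ := hq i
    obtain ⟨T, hT⟩ := hq j
    rw [← hS, ← hT, ← hr4, ← hr4] at heq
    rw [← hS, ← hT, Subtype.ext heq] at hlt
    exact lt_irrefl _ hlt
  have hg : ∀ i : Fin n, ∃ g, α ≤ g ∧ g < q i ∧ (∀ k, k < i → q k < g) ∧ circlePt g ∉ A := by
    intro i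
    by_cases hi : i.1 = 0
    · exact ⟨α, le_rfl, hq1 i, fun k hk => absurd (Fin.lt_def.1 hk) (by omega), hp.2⟩
    · obtain ⟨g, h1, h2, h3⟩ := hq4 ⟨i.1 - 1, by omega⟩ i (Fin.lt_def.2 (by simp; omega))
      refine ⟨g, (hq1 _).le.trans h1.le, h2, fun k hk => lt_of_le_of_lt (q.monotone ?_) h1, h3⟩
      rw [Fin.le_def]
      have := Fin.lt_def.1 hk
      simp; omega
  choose g hg1 hg2 hg3 hg4 using hg
  refine ⟨fun i => circlePt (g i), fun i => ⟨circlePt_mem _, hg4 i⟩, fun i j hij heq => ?_⟩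
  have hD := connectedComponentIn_subset (S1 \ A) (circlePt (g j))
  have hmi : circlePt (g i) ∈ connectedComponentIn (S1 \ A) (circlePt (g j)) :=
    heq ▸ mem_connectedComponentIn ⟨circlePt_mem _, hg4 i⟩
  have hmj : circlePt (g j) ∈ connectedComponentIn (S1 \ A) (circlePt (g j)) :=
    mem_connectedComponentIn ⟨circlePt_mem _, hg4 j⟩
  have hout : ∀ k, circlePt (q k) ∉ connectedComponentIn (S1 \ A) (circlePt (g j)) :=
    fun k h => (hD h).2 (hq3 k)
  by_cases hi : i.1 = 0
  · refine isPreconnected_connectedComponentIn.circlePt_notMem (hD.trans sdiff_subset)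
      (hg3 j i hij) (hg2 j) (y := g i + 2 * Real.pi) ?_ ?_ (hout i) (hout j) hmj ?_
    · linarith [hq2 j, hg1 i]
    · linarith [hg2 i]
    · rwa [circlePt_add_two_pi]
  · have hk : (⟨0, by omega⟩ : Fin n) < i := Fin.lt_def.2 (by simp; omega)
    refine isPreconnected_connectedComponentIn.circlePt_notMem (hD.trans sdiff_subset)
      (hg3 i _ hk) (hg2 i) (hg3 j i hij) ?_ (hout _) (hout i) hmi hmj
    linarith [hg2 j, hq2 j, hq1 ⟨0, by omega⟩]

section Counting

variable {V W : Type*} [DecidableEq V] [DecidableEq W] {g : V → V → W}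

/-- Some member of a finite family has all the others in a single gap. -/
lemma exists_forall_gap_eq {s : Finset V} (hs : 2 ≤ s.card)
    (hg : ∀ A ∈ s, ∀ B ∈ s, ∀ X ∈ s, A ≠ B → X ≠ A → X ≠ B → g A X ≠ g A B → g B X = g B A) :
    ∃ A ∈ s, ∃ w, ∀ B ∈ s, B ≠ A → g A B = w := by
  obtain ⟨A₀, hA₀, B₀, hB₀, hne⟩ := Finset.one_lt_card.1 hs
  let N : V × V → Finset V := fun q => {X ∈ s | X ≠ q.1 ∧ g q.1 X = g q.1 q.2}
  obtain ⟨⟨A, B⟩, hAB, hmax⟩ := Finset.exists_max_image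
    ({q ∈ s ×ˢ s | q.1 ≠ q.2}) (fun q => (N q).card) ⟨(A₀, B₀), by simp [hA₀, hB₀, hne]⟩
  simp only [Finset.mem_filter, Finset.mem_product] at hAB hmax
  refine ⟨A, hAB.1.1, g A B, fun Y hY hYA => ?_⟩
  by_contra hYB
  have hlt : N (A, B) ⊂ N (Y, A) := by
    rw [Finset.ssubset_iff_of_subset]
    · exact ⟨A, by simp [N, hAB.1.1, hYA.symm], by simp [N]⟩
    · intro X hX
      simp only [N, Finset.mem_filter] at hX ⊢
      have hXY : X ≠ Y := by rintro rfl; exact hYB hX.2.2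
      exact ⟨hX.1, hXY, hg A hAB.1.1 Y hY X hX.1 hYA.symm hX.2.1 hXY
        (by rw [hX.2.2]; exact fun h => hYB h.symm)⟩
  exact absurd (hmax (Y, A) ⟨⟨hY, hAB.1.1⟩, hYA⟩) (not_le.2 (Finset.card_lt_card hlt))

lemma sum_card_gaps_add_two_le (U : Set V)
    (hg : ∀ A ∈ U, ∀ B ∈ U, ∀ X ∈ U, A ≠ B → X ≠ A → X ≠ B → g A X ≠ g A B → g B X = g B A)
    (k : ℕ) : ∀ (s T : Finset V), s.card = k + 1 → ↑s ⊆ U → ↑T ⊆ U → Disjoint s T →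
      (∀ A ∈ s, 2 ≤ (T.image (g A)).card) →
      ∑ A ∈ s, ((T.image (g A)).card - 2) + 2 ≤ T.card := by
  induction k with
  | zero =>
    intro s T hs _ _ _ h2
    obtain ⟨A, rfl⟩ := Finset.card_eq_one.1 hs
    have h := h2 A (Finset.mem_singleton_self A)
    have h' := Finset.card_image_le (s := T) (f := g A)
    rw [Finset.sum_singleton]
    omega
  | succ k ih =>
    intro s T hs hsU hTU hd h2
    obtain ⟨A, hA, w, hw⟩ := exists_forall_gap_eq (g := g) (s := s) (by omega)
      fun A hA B hB X hX => hg A (hsU hA) B (hsU hB) X (hsU hX)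
    obtain ⟨v, hv, hvw⟩ := Finset.exists_mem_ne (h2 A hA) w
    obtain ⟨t, ht, rfl⟩ := Finset.mem_image.1 hv
    let T' := {x ∈ T | g A x = w ∨ x = t}
    have hT' : T' ⊆ T := Finset.filter_subset _ _
    have htT' : t ∈ T' := by simp [T', ht]
    have hne : ∀ x ∈ T, ∀ B ∈ s, x ≠ B := fun x hx B hB h =>
      Finset.disjoint_left.1 hd hB (h ▸ hx)
    have himg : ∀ B ∈ s.erase A, T'.image (g B) = T.image (g B) := by
      intro B hB
      obtain ⟨hBA, hB⟩ := Finset.mem_erase.1 hB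
      refine (Finset.image_subset_image hT').antisymm fun v hv => ?_
      obtain ⟨x, hx, rfl⟩ := Finset.mem_image.1 hv
      have hgB : ∀ y ∈ T, g A y ≠ w → g B y = g B A := fun y hy hyw =>
        hg A (hsU hA) B (hsU hB) y (hTU hy) hBA.symm (hne y hy A hA) (hne y hy B hB)
          (by rwa [hw B hB hBA])
      by_cases hxw : g A x = w
      · exact Finset.mem_image_of_mem _ (by simp [T', hx, hxw])
      · rw [hgB x hx hxw, ← hgB t ht hvw]
        exact Finset.mem_image_of_mem _ htT'
    have hrec := ih (s.erase A) T' (by rw [Finset.card_erase_of_mem hA]; omega)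
      ((Finset.coe_subset.2 (Finset.erase_subset _ _)).trans hsU)
      ((Finset.coe_subset.2 hT').trans hTU)
      (hd.mono (Finset.erase_subset _ _) hT')
      fun B hB => by rw [himg B hB]; exact h2 B (Finset.mem_of_mem_erase hB)
    rw [Finset.sum_congr rfl fun B hB => by rw [himg B hB]] at hrec
    have hdiff : (T.image (g A)).card - 2 ≤ (T \ T').card := by
      have hsub : T.image (g A) \ {w, g A t} ⊆ (T \ T').image (g A) := by
        intro v hv
        simp only [Finset.mem_sdiff, Finset.mem_image, Finset.mem_insert,
          Finset.mem_singleton] at hv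
        obtain ⟨⟨x, hx, rfl⟩, hxv⟩ := hv
        push Not at hxv
        refine Finset.mem_image_of_mem _ ?_
        simp only [T', Finset.mem_sdiff, Finset.mem_filter, not_and, not_or]
        exact ⟨hx, fun _ => ⟨hxv.1, by rintro rfl; exact hxv.2 rfl⟩⟩
      have e1 := Finset.le_card_sdiff {w, g A t} (T.image (g A))
      have e2 := Finset.card_le_two (a := w) (b := g A t)
      have e3 := (Finset.card_le_card hsub).trans Finset.card_image_le
      omega
    have hT := Finset.card_sdiff_add_card_eq_card hT'
    rw [← Finset.add_sum_erase s _ hA]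
    omega

end Counting

lemma ncard_componentsOf_le_one {X : Type*} [TopologicalSpace X] {A : Set X}
    (hA : IsPreconnected A) : (componentsOf A).ncard ≤ 1 := by
  refine (Set.ncard_le_ncard (t := {A}) ?_ (Set.finite_singleton A)).trans
    (Set.ncard_singleton A).le
  rintro _ ⟨p, hp, rfl⟩
  exact hA.connectedComponentIn hp

/-- **Bose-type formula for nested partitions of `S¹`.** If `P` is a nested
partition of `S¹` with at least two parts, then (1) for every part `A`, every
connected component of `S¹ \ A` contains a singular (connected) part of `P`;
and (2) for any finite family of pairwise distinct parts with finitely many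
components, of ranks `n_j ≥ 3`, there are at least `∑ (n_j − 2) + 2` singular
parts. -/
theorem nested_partition_bose (P : Set (Set (ℝ × ℝ)))
    (hpart : IsPartitionOfS1 P) (hnest : IsNestedPartition P)
    (hnontriv : ∃ A ∈ P, ∃ B ∈ P, A ≠ B) :
    (∀ A ∈ P, ∀ p ∈ S1 \ A,
      ∃ B ∈ P, IsConnected B ∧ B ⊆ connectedComponentIn (S1 \ A) p) ∧
    (∀ (m : ℕ) (Q : Fin m → Set (ℝ × ℝ)) (n : Fin m → ℕ),
      Function.Injective Q → (∀ j, Q j ∈ P) →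
      (∀ j, (componentsOf (Q j)).ncard = n j ∧ 3 ≤ n j) →
      ∃ S : Fin ((∑ j, (n j - 2)) + 2) → Set (ℝ × ℝ),
        Function.Injective S ∧ ∀ i, S i ∈ P ∧ IsConnected (S i)) := by
  classical
  have hsing : ∀ A ∈ P, ∀ p ∈ S1 \ A,
      ∃ B ∈ P, IsConnected B ∧ B ⊆ connectedComponentIn (S1 \ A) p :=
    fun A hA p hp => hnest.exists_isConnected hpart hA hp
  refine ⟨hsing, fun m Q n hQ hQP hn => ?_⟩
  have hother : ∀ A ∈ P, (S1 \ A).Nonempty := by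
    intro A hA
    obtain ⟨B, hB, hBA⟩ : ∃ B ∈ P, B ≠ A := by
      obtain ⟨C, hC, D, hD, hCD⟩ := hnontriv
      by_cases h : C = A
      · exact ⟨D, hD, fun h' => hCD (h.trans h'.symm)⟩
      · exact ⟨C, hC, h⟩
    obtain ⟨b, hb⟩ := (hpart.1 B hB).1
    exact ⟨b, (hpart.1 B hB).2 hb, fun h => hBA (hpart.eq_of_mem hB hA hb h)⟩
  suffices h : ∃ T : Finset (Set (ℝ × ℝ)), (∀ B ∈ T, B ∈ P ∧ IsConnected B) ∧
      (∑ j, (n j - 2)) + 2 ≤ T.card by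
    obtain ⟨T, hT, hcard⟩ := h
    refine ⟨fun i => (T.equivFin.symm (Fin.castLE hcard i)).1, fun i j hij => ?_,
      fun i => hT _ (T.equivFin.symm (Fin.castLE hcard i)).2⟩
    exact Fin.castLE_injective hcard (T.equivFin.symm.injective (Subtype.ext hij))
  have hnotMem : ∀ A ∈ P, ∀ B ∈ P, ∀ p, B ⊆ connectedComponentIn (S1 \ A) p → B ≠ A := by
    rintro A - B hB p hBp rfl
    obtain ⟨b, hb⟩ := (hpart.1 B hB).1
    exact (connectedComponentIn_subset _ _ (hBp hb)).2 hb
  rcases Nat.eq_zero_or_pos m with rfl | hm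
  · obtain ⟨A, hA, -⟩ := hnontriv
    obtain ⟨p, hp⟩ := hother A hA
    obtain ⟨B, hB, hBc, -⟩ := hsing A hA p hp
    obtain ⟨q, hq⟩ := hother B hB
    obtain ⟨C, hC, hCc, hCB⟩ := hsing B hB q hq
    refine ⟨{B, C}, ?_, ?_⟩
    · simp only [Finset.mem_insert, Finset.mem_singleton]
      rintro D (rfl | rfl)
      exacts [⟨hB, hBc⟩, ⟨hC, hCc⟩]
    · rw [Finset.card_pair (hnotMem B hB C hC q hCB).symm]
      simp
  have hpts : ∀ j, ∃ t : Fin (n j) → Set (ℝ × ℝ), (∀ i, t i ∈ P ∧ IsConnected (t i)) ∧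
      Function.Injective fun i => gapOf (Q j) (t i) := by
    intro j
    obtain ⟨p, hp, hsep⟩ := exists_gap_points (hpart.1 _ (hQP j)).2 (hother _ (hQP j)) (hn j).1
      (by have := (hn j).2; omega)
    choose t ht htc hts using fun i => hsing (Q j) (hQP j) (p i) (hp i)
    have hgap : ∀ i, gapOf (Q j) (t i) = connectedComponentIn (S1 \ Q j) (p i) := by
      intro i
      obtain ⟨q, hq⟩ := (hpart.1 _ (ht i)).1
      rw [hnest.gapOf_eq hpart (hQP j) (ht i) (hnotMem _ (hQP j) _ (ht i) _ (hts i)) hq,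
        ← connectedComponentIn_eq (hts i hq)]
    refine ⟨t, fun i => ⟨ht i, htc i⟩, fun i k hik => ?_⟩
    simp only [hgap] at hik
    by_contra hne
    rcases lt_or_gt_of_ne hne with h | h
    exacts [hsep i k h hik, hsep k i h hik.symm]
  choose t ht htinj using hpts
  let T : Finset (Set (ℝ × ℝ)) := Finset.univ.biUnion fun j => Finset.univ.image (t j)
  have hT : ∀ B ∈ T, B ∈ P ∧ IsConnected B := by
    intro B hB
    simp only [T, Finset.mem_biUnion, Finset.mem_image, Finset.mem_univ, true_and] at hB
    obtain ⟨j, i, rfl⟩ := hB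
    exact ht j i
  have hle : ∀ j, n j ≤ (T.image (gapOf (Q j))).card := by
    intro j
    have h := Finset.card_image_of_injective Finset.univ (htinj j)
    rw [Finset.card_univ, Fintype.card_fin] at h
    rw [← h]
    refine Finset.card_le_card fun w hw => ?_
    obtain ⟨i, -, rfl⟩ := Finset.mem_image.1 hw
    refine Finset.mem_image_of_mem _ (Finset.mem_biUnion.2 ⟨j, Finset.mem_univ j, ?_⟩)
    exact Finset.mem_image_of_mem _ (Finset.mem_univ i)
  refine ⟨T, hT, ?_⟩
  have hcount := sum_card_gaps_add_two_le (g := gapOf) P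
    (fun A hA B hB X hX => hnest.gapOf_eq_gapOf hpart hA hB hX) (m - 1)
    (Finset.univ.image Q) T
    (by rw [Finset.card_image_of_injective _ hQ, Finset.card_univ, Fintype.card_fin]; omega)
    (by intro A hA; simp at hA; obtain ⟨j, rfl⟩ := hA; exact hQP j)
    (fun B hB => (hT B hB).1)
    (by
      rw [Finset.disjoint_left]
      intro A hA hAT
      obtain ⟨j, -, rfl⟩ := Finset.mem_image.1 hA
      have h1 := ncard_componentsOf_le_one (hT _ hAT).2.isPreconnected
      have h2 := hn j
      omega)
    (by
      intro A hA
      obtain ⟨j, -, rfl⟩ := Finset.mem_image.1 hA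
      have h1 := hle j
      have h2 := (hn j).2
      omega)
  rw [Finset.sum_image hQ.injOn] at hcount
  refine le_trans ?_ hcount
  gcongr with j
  exact hle j
end
end

section
/- Let n ≥ 2, let K ⊆ ℝⁿ be a convex body, and let H = {x : ⟨x, u⟩ = c} (u a unit vector) be a hyperplane with closed side H⁺ = {x : ⟨x, u⟩ ≥ c}, such that H ∩ K has nonempty interior relative to H and int H⁺ contains an interior point of K; let C := cl(∂K ∩ int H⁺) be the corresponding nondegenerate cap. Suppose o ∈ H and 0 < r ≤ R are such that {x ∈ H⁺ : ‖x − o‖ ≤ r} ⊆ conv(C) and conv(C) ⊆ {x : ‖x − o‖ ≤ R}. Then for all x, y ∈ C, the intrinsic distance of x and y in C satisfies d(x, y) ≤ 4(2 + π)(R/r)·‖x − y‖; that is, the distortion of C is at most 4(2 + π)R/r. -/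
open Set Metric Real
open scoped RealInnerProductSpace ENNReal

noncomputable section

/-- A convex body in `ℝᵈ`. -/
def IsConvexBodyE {d : ℕ} (K : Set (EuclideanSpace ℝ (Fin d))) : Prop :=
  IsCompact K ∧ Convex ℝ K ∧ (interior K).Nonempty

/-- The intrinsic distance between `x` and `y` in `X`: the infimum of lengths
(total variations) of continuous paths in `X` joining `x` to `y`. -/
def intrinsicDist {d : ℕ} (X : Set (EuclideanSpace ℝ (Fin d)))
    (x y : EuclideanSpace ℝ (Fin d)) : ℝ≥0∞ :=
  sInf {L | ∃ σ : ℝ → EuclideanSpace ℝ (Fin d),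
    ContinuousOn σ (Icc 0 1) ∧ MapsTo σ (Icc 0 1) X ∧
    σ 0 = x ∧ σ 1 = y ∧ L = eVariationOn σ (Icc 0 1)}

section Paths

variable {d : ℕ} {X : Set (EuclideanSpace ℝ (Fin d))} {x y z : EuclideanSpace ℝ (Fin d)}

theorem intrinsicDist_triangle :
    intrinsicDist X x z ≤ intrinsicDist X x y + intrinsicDist X y z := by
  refine ENNReal.le_of_forall_pos_le_add fun ε hε hfin => ?_
  have hε' : (ε / 2 : ℝ≥0∞) ≠ 0 := by simpa using hε.ne'
  obtain ⟨L₁, ⟨σ, hσc, hσm, hσ0, hσ1, rfl⟩, h₁⟩ := sInf_lt_iff.1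
    (ENNReal.lt_add_right (ENNReal.add_lt_top.1 hfin).1.ne hε')
  obtain ⟨L₂, ⟨τ, hτc, hτm, hτ0, hτ1, rfl⟩, h₂⟩ := sInf_lt_iff.1
    (ENNReal.lt_add_right (ENNReal.add_lt_top.1 hfin).2.ne hε')
  let ρ : ℝ → EuclideanSpace ℝ (Fin d) := fun t => if t ≤ 1 / 2 then σ (2 * t) else τ (2 * t - 1)
  have hl : EqOn ρ (σ ∘ fun t => 2 * t) (Icc 0 (1 / 2)) := fun t ht => if_pos ht.2
  have hr : EqOn ρ (τ ∘ fun t => 2 * t - 1) (Icc (1 / 2) 1) := by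
    intro t ht
    rcases ht.1.eq_or_lt with rfl | h
    · simp [ρ, hσ1, hτ0]
    · exact if_neg h.not_ge
  have ml : MapsTo (fun t : ℝ => 2 * t) (Icc 0 (1 / 2)) (Icc 0 1) := fun t ht =>
    ⟨by linarith [ht.1], by linarith [ht.2]⟩
  have mr : MapsTo (fun t : ℝ => 2 * t - 1) (Icc (1 / 2) 1) (Icc 0 1) := fun t ht =>
    ⟨by linarith [ht.1], by linarith [ht.2]⟩
  have hun : Icc (0 : ℝ) (1 / 2) ∪ Icc (1 / 2) 1 = Icc 0 1 :=
    Icc_union_Icc_eq_Icc (by norm_num) (by norm_num)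
  have hvar : eVariationOn ρ (Icc 0 1) ≤ eVariationOn σ (Icc 0 1) + eVariationOn τ (Icc 0 1) := by
    have := eVariationOn.Icc_add_Icc ρ (s := univ) (a := 0) (b := 1 / 2) (c := 1)
      (by norm_num) (by norm_num) (mem_univ _)
    simp only [univ_inter] at this
    rw [← this, eVariationOn.eq_of_eqOn hl, eVariationOn.eq_of_eqOn hr]
    refine add_le_add (eVariationOn.comp_le_of_monotoneOn _ _ ?_ ml)
      (eVariationOn.comp_le_of_monotoneOn _ _ ?_ mr)
    · intro a _ b _ hab
      dsimp only
      linarith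
    · intro a _ b _ hab
      dsimp only
      linarith
  have hle : intrinsicDist X x z ≤ eVariationOn ρ (Icc 0 1) := by
    refine sInf_le ⟨ρ, ?_, ?_, ?_, ?_, rfl⟩
    · rw [← hun]
      refine ContinuousOn.union_of_isClosed ?_ ?_ isClosed_Icc isClosed_Icc
      · exact (hσc.comp (by fun_prop) ml).congr hl
      · exact (hτc.comp (by fun_prop) mr).congr hr
    · rw [← hun]
      rintro t (ht | ht)
      · rw [hl ht]
        exact hσm (ml ht)
      · rw [hr ht]
        exact hτm (mr ht)
    · simp [ρ, hσ0]
    · have : ¬ (1 : ℝ) ≤ 1 / 2 := by norm_num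
      simp only [ρ, if_neg this]
      rw [← hτ1]
      norm_num
  calc intrinsicDist X x z ≤ _ := hle
    _ ≤ _ := hvar
    _ ≤ (intrinsicDist X x y + ε / 2) + (intrinsicDist X y z + ε / 2) := add_le_add h₁.le h₂.le
    _ = _ := by rw [add_add_add_comm, ENNReal.add_halves]

theorem intrinsicDist_le_of_segment_mapsTo {P : EuclideanSpace ℝ (Fin d) → EuclideanSpace ℝ (Fin d)}
    (hP : LipschitzWith 1 P) {p q : EuclideanSpace ℝ (Fin d)} (h : MapsTo P (segment ℝ p q) X) :
    intrinsicDist X (P p) (P q) ≤ ENNReal.ofReal ‖p - q‖ := by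
  have hlip : LipschitzWith (nndist p q) (P ∘ AffineMap.lineMap (k := ℝ) p q) := by
    simpa using hP.comp (lipschitzWith_lineMap (𝕜 := ℝ) p q)
  have hle : intrinsicDist X (P p) (P q) ≤
      eVariationOn (P ∘ AffineMap.lineMap (k := ℝ) p q) (Icc 0 1) := by
    refine sInf_le ⟨_, hlip.continuous.continuousOn, ?_, by simp, by simp, rfl⟩
    intro t ht
    refine h ?_
    rw [segment_eq_image_lineMap]
    exact mem_image_of_mem _ ht
  refine hle.trans ?_
  refine ((hlip.lipschitzOnWith (s := Icc 0 1)).comp_eVariationOn_le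
    (g := id) (mapsTo_id _)).trans ?_
  have h1 : eVariationOn (id : ℝ → ℝ) (Icc 0 1) ≤ 1 := by
    have := (monotoneOn_id (s := Icc (0 : ℝ) 1)).eVariationOn_eq
      (left_mem_Icc.2 zero_le_one) (right_mem_Icc.2 zero_le_one)
    simp_all
  calc _ ≤ (nndist p q : ℝ≥0∞) * 1 := by gcongr
    _ = _ := by rw [mul_one, ← dist_eq_norm, ← edist_dist, edist_nndist]

end Paths

section Projection

variable {E : Type*} [NormedAddCommGroup E] [InnerProductSpace ℝ E]

theorem exists_lipschitz_nearest_point [CompleteSpace E] {M : Set E} (hne : M.Nonempty)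
    (hM : IsClosed M) (hconv : Convex ℝ M) :
    ∃ P : E → E, LipschitzWith 1 P ∧ (∀ z, P z ∈ M) ∧ (∀ z ∈ M, P z = z) ∧
      ∀ z, ∀ k ∈ M, ⟪z - P z, k - P z⟫ ≤ 0 := by
  choose P hPM hP using exists_norm_eq_iInf_of_complete_convex hne hM.isComplete hconv
  have hvar : ∀ z, ∀ k ∈ M, ⟪z - P z, k - P z⟫ ≤ 0 := fun z =>
    (norm_eq_iInf_iff_real_inner_le_zero hconv (hPM z)).1 (hP z)
  refine ⟨P, LipschitzWith.of_dist_le_mul fun x y => ?_, hPM, fun z hz => ?_, hvar⟩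
  · have h1 := hvar x (P y) (hPM y)
    have h2 := hvar y (P x) (hPM x)
    have h3 : ‖P x - P y‖ ^ 2 ≤ ⟪x - y, P x - P y⟫ := by
      rw [← real_inner_self_eq_norm_sq]
      simp only [inner_sub_left, inner_sub_right] at h1 h2 ⊢
      linarith [real_inner_comm (P x) (P y)]
    have h4 := real_inner_le_norm (x - y) (P x - P y)
    rw [dist_eq_norm, dist_eq_norm, NNReal.coe_one, one_mul]
    by_contra! h
    nlinarith [norm_nonneg (P x - P y), norm_nonneg (x - y)]
  · have := hvar z z hz
    rw [real_inner_self_nonpos, sub_eq_zero] at this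
    exact this.symm

end Projection

section Cap

variable {E : Type*} [NormedAddCommGroup E] [InnerProductSpace ℝ E]
  {K : Set E} {u o : E} {c r R : ℝ}

/-- The vectors `v` of the half-space `⟪u, v⟫ ≥ 0` such that the ray from `o` through `o + v`
does not meet `K` beyond `o + v`. -/
def outerVectors (K : Set E) (u o : E) : Set E :=
  {v | 0 ≤ ⟪u, v⟫ ∧ ∀ t : ℝ, 1 < t → o + t • v ∉ K}

theorem smul_mem_outerVectors {v : E} (hv : v ∈ outerVectors K u o) {s : ℝ} (hs : 1 ≤ s) :
    s • v ∈ outerVectors K u o := by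
  refine ⟨?_, fun t ht => ?_⟩
  · rw [inner_smul_right]
    exact mul_nonneg (by linarith) hv.1
  · rw [smul_smul]
    exact hv.2 _ (by nlinarith)

theorem halfBall_subset_interior
    (hball : ∀ v, 0 ≤ ⟪u, v⟫ → ‖v‖ ≤ r → o + v ∈ K) {v : E} (hv : 0 < ⟪u, v⟫) (hvr : ‖v‖ < r) :
    o + v ∈ interior K := by
  have hopen : IsOpen ({x | 0 < ⟪u, x - o⟫} ∩ {x | ‖x - o‖ < r}) :=
    (isOpen_lt (by fun_prop) (by fun_prop)).inter (isOpen_lt (by fun_prop) (by fun_prop))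
  refine interior_maximal ?_ hopen ⟨by simpa using hv, by simpa using hvr⟩
  rintro x ⟨h1, h2⟩
  simpa using hball _ h1.le h2.le

theorem exists_halfBall_subset_of_notMem_cap (hK : Convex ℝ K) (hKc : IsClosed K)
    (hu : ‖u‖ = 1) (ho : ⟪u, o⟫ = c) (hr : 0 < r)
    (hball : ∀ v, 0 ≤ ⟪u, v⟫ → ‖v‖ ≤ r → o + v ∈ K) {w : E} (hw : w ∈ K) (hwc : c ≤ ⟪u, w⟫)
    (hwC : w ∉ closure (frontier K ∩ {y | c < ⟪u, y⟫})) :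
    ∃ ε > 0, ∀ v, ‖v - w‖ < ε → c ≤ ⟪u, v⟫ → v ∈ K := by
  obtain ⟨ε, hε, hdisj⟩ : ∃ ε > 0, ball w ε ∩ (frontier K ∩ {y | c < ⟪u, y⟫}) = ∅ := by
    rw [Metric.mem_closure_iff] at hwC
    push Not at hwC
    obtain ⟨ε, hε, h⟩ := hwC
    refine ⟨ε, hε, eq_empty_of_forall_notMem ?_⟩
    rintro y ⟨hy, hy'⟩
    have := h y hy'
    rw [mem_ball, dist_comm] at hy
    linarith
  have huu : ⟪u, u⟫ = 1 := by rw [real_inner_self_eq_norm_sq, hu, one_pow]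
  have hpre : IsPreconnected (ball w ε ∩ {y | c < ⟪u, y⟫}) :=
    ((convex_ball w ε).inter (convex_halfSpace_gt
      (f := fun y => ⟪u, y⟫) (innerₛₗ ℝ u).isLinear c)).isPreconnected
  have hopenK : ball w ε ∩ {y | c < ⟪u, y⟫} ⊆ K := by
    by_contra hnot
    obtain ⟨z, hz, hzK⟩ := not_subset.1 hnot
    set p := o + (r / 2) • u with hp
    have hpK : p ∈ interior K := by
      refine halfBall_subset_interior hball ?_ ?_
      · rw [inner_smul_right, huu]
        linarith
      · rw [norm_smul, hu, Real.norm_of_nonneg (by linarith)]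
        linarith
    have hpc : ⟪u, p⟫ = c + r / 2 := by
      rw [hp, inner_add_right, inner_smul_right, huu, ho, mul_one]
    have hpos : 0 < ‖p - w‖ + 1 := by positivity
    set t := min 1 (ε / (‖p - w‖ + 1) / 2) with ht
    have ht0 : 0 < t := by positivity
    have ht1 : t ≤ 1 := min_le_left _ _
    have hq : w + t • (p - w) ∈ (ball w ε ∩ {y | c < ⟪u, y⟫}) ∩ K := by
      refine ⟨⟨?_, ?_⟩, hK.add_smul_sub_mem hw (interior_subset hpK) ⟨ht0.le, ht1⟩⟩
      · rw [mem_ball, dist_eq_norm, add_sub_cancel_left, norm_smul, Real.norm_of_nonneg ht0.le]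
        have h1 : t * (‖p - w‖ + 1) ≤ ε / 2 := by
          calc t * (‖p - w‖ + 1) ≤ ε / (‖p - w‖ + 1) / 2 * (‖p - w‖ + 1) := by
                gcongr
                exact min_le_right _ _
            _ = ε / 2 := by field_simp
        nlinarith
      · simp only [mem_ofPred_eq, inner_add_right, inner_smul_right, inner_sub_right, hpc]
        nlinarith
    have hint : ∀ y ∈ ball w ε ∩ {y | c < ⟪u, y⟫}, y ∈ K → y ∈ interior K := by
      intro y hy hyK
      by_contra hyi
      have : y ∈ (∅ : Set E) := hdisj ▸ ⟨hy.1, ⟨subset_closure hyK, hyi⟩, hy.2⟩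
      exact this
    obtain ⟨y, -, hyi, hyc⟩ := hpre _ _ isOpen_interior hKc.isOpen_compl
      (fun y hy => (em (y ∈ K)).imp (hint y hy) id) ⟨_, hq.1, hint _ hq.1 hq.2⟩ ⟨z, hz, hzK⟩
    exact hyc (interior_subset hyi)
  refine ⟨ε, hε, fun v hv hvc => ?_⟩
  have hlim : Filter.Tendsto (fun t : ℝ => v + t • u) (nhdsWithin 0 (Ioi 0)) (nhds v) := by
    have : Continuous fun t : ℝ => v + t • u := by fun_prop
    simpa using (this.tendsto 0).mono_left nhdsWithin_le_nhds
  refine hKc.mem_of_tendsto hlim ?_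
  have hvb : v ∈ ball w ε := by rwa [mem_ball, dist_eq_norm]
  filter_upwards [hlim.eventually (isOpen_ball.mem_nhds hvb), self_mem_nhdsWithin] with t ht ht0
  refine hopenK ⟨ht, ?_⟩
  rw [mem_Ioi] at ht0
  simp only [mem_ofPred_eq, inner_add_right, inner_smul_right, huu]
  linarith

theorem exists_one_lt_ray_mem (hK : Convex ℝ K) (hKc : IsClosed K)
    (hu : ‖u‖ = 1) (ho : ⟪u, o⟫ = c) (hr : 0 < r)
    (hball : ∀ v, 0 ≤ ⟪u, v⟫ → ‖v‖ ≤ r → o + v ∈ K) {v : E} (hv : o + v ∈ K) (hvc : 0 ≤ ⟪u, v⟫)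
    (hvC : o + v ∉ closure (frontier K ∩ {y | c < ⟪u, y⟫})) :
    ∃ t : ℝ, 1 < t ∧ o + t • v ∈ K := by
  obtain ⟨ε, hε, h⟩ := exists_halfBall_subset_of_notMem_cap hK hKc hu ho hr hball hv
    (by rw [inner_add_right, ho]; linarith) hvC
  have hpos : 0 < ‖v‖ + 1 := by positivity
  have hs : 0 < ε / (‖v‖ + 1) := by positivity
  refine ⟨1 + ε / (‖v‖ + 1), by linarith, h _ ?_ ?_⟩
  · have : o + (1 + ε / (‖v‖ + 1)) • v - (o + v) = (ε / (‖v‖ + 1)) • v := by module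
    rw [this, norm_smul, Real.norm_of_nonneg hs.le, div_mul_eq_mul_div, div_lt_iff₀ hpos]
    nlinarith
  · rw [inner_add_right, inner_smul_right, ho]
    nlinarith

theorem sub_mem_outerVectors_of_mem_cap (hK : Convex ℝ K)
    (ho : ⟪u, o⟫ = c) (hr : 0 < r)
    (hball : ∀ v, 0 ≤ ⟪u, v⟫ → ‖v‖ ≤ r → o + v ∈ K) {x : E}
    (hx : x ∈ closure (frontier K ∩ {y | c < ⟪u, y⟫})) :
    x - o ∈ outerVectors K u o := by
  have hsub : closure (frontier K ∩ {y | c < ⟪u, y⟫}) ⊆ {y | c ≤ ⟪u, y⟫} :=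
    closure_minimal (fun y ⟨_, (hy : c < ⟪u, y⟫)⟩ => hy.le)
      (isClosed_le (by fun_prop) (by fun_prop))
  have hxc : c ≤ ⟪u, x⟫ := hsub hx
  have hxf : x ∈ frontier K := closure_minimal inter_subset_left isClosed_frontier hx
  refine ⟨by rw [inner_sub_right, ho]; linarith, fun t ht hp => ?_⟩
  set a := x - o with ha
  have hxa : x = o + a := by rw [ha]; abel
  have ht0 : 0 < t := by linarith
  have hs : t⁻¹ < 1 := inv_lt_one_of_one_lt₀ ht
  have hs0 : 0 < t⁻¹ := by positivity
  rcases hxc.eq_or_lt with hc | hc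
  · obtain ⟨x', ⟨hx'f, hx'c⟩, hx'⟩ := Metric.mem_closure_iff.1 hx (r * (1 - t⁻¹))
      (mul_pos hr (by linarith))
    rw [mem_ofPred_eq] at hx'c
    rw [dist_comm, dist_eq_norm] at hx'
    have h1 : 0 < (1 - t⁻¹)⁻¹ := inv_pos.2 (by linarith)
    have hq : o + (1 - t⁻¹)⁻¹ • (x' - x) ∈ interior K := by
      refine halfBall_subset_interior hball ?_ ?_
      · rw [inner_smul_right, inner_sub_right]
        exact mul_pos h1 (by linarith)
      · rw [norm_smul, Real.norm_of_nonneg h1.le, inv_mul_lt_iff₀ (by linarith)]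
        linarith
    refine hx'f.2 ?_
    convert hK.combo_interior_self_mem_interior hq hp (a := 1 - t⁻¹) (b := t⁻¹) (by linarith)
      hs0.le (by ring) using 1
    have h2 : (1 - t⁻¹) ≠ 0 := by linarith
    rw [smul_add, smul_add, smul_smul, smul_smul, mul_inv_cancel₀ h2, inv_mul_cancel₀ ht0.ne',
      ha]
    module
  · have hap : 0 < ⟪u, a⟫ := by rw [ha, inner_sub_right]; linarith
    have hpos : 0 < ‖a‖ + 1 := by positivity
    set l := min (1 / 2) (r / (‖a‖ + 1)) with hl
    have hl0 : 0 < l := by positivity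
    have hl1 : l ≤ 1 / 2 := min_le_left _ _
    have hq : o + l • a ∈ interior K := by
      refine halfBall_subset_interior hball ?_ ?_
      · rw [inner_smul_right]
        positivity
      · rw [norm_smul, Real.norm_of_nonneg hl0.le]
        have : l * (‖a‖ + 1) ≤ r := by
          calc l * (‖a‖ + 1) ≤ r / (‖a‖ + 1) * (‖a‖ + 1) := by
                gcongr
                exact min_le_right _ _
            _ = r := by field_simp
        linarith
    refine hxf.2 ?_
    have htl : 0 < t - l := by linarith
    convert hK.combo_interior_self_mem_interior hq hp (a := (t - 1) / (t - l))
      (b := (1 - l) / (t - l)) (by apply div_pos <;> linarith)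
      (by apply div_nonneg <;> linarith) (by field_simp; ring) using 1
    rw [hxa]
    match_scalars <;> field_simp <;> ring

theorem nearest_point_mem_cap (hK : Convex ℝ K) (hKc : IsClosed K)
    (hu : ‖u‖ = 1) (ho : ⟪u, o⟫ = c) (hr : 0 < r)
    (hball : ∀ v, 0 ≤ ⟪u, v⟫ → ‖v‖ ≤ r → o + v ∈ K) {v w : E}
    (hv : v ∈ outerVectors K u o) (hw : w ∈ K) (hwc : c ≤ ⟪u, w⟫)
    (hproj : ∀ k ∈ K ∩ {x | c ≤ ⟪u, x⟫}, ⟪o + v - w, k - w⟫ ≤ 0) :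
    w ∈ closure (frontier K ∩ {y | c < ⟪u, y⟫}) := by
  by_contra hwC
  obtain ⟨ε, hε, h⟩ := exists_halfBall_subset_of_notMem_cap hK hKc hu ho hr hball hw hwc hwC
  have hz : c ≤ ⟪u, o + v⟫ := by
    rw [inner_add_right, ho]
    linarith [hv.1]
  set z := o + v with hzdef
  have hpos : 0 < ‖z - w‖ + 1 := by positivity
  set t := min 1 (ε / (‖z - w‖ + 1) / 2) with ht
  have ht0 : 0 < t := by positivity
  have ht1 : t ≤ 1 := min_le_left _ _
  have hc' : c ≤ ⟪u, w + t • (z - w)⟫ := by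
    rw [inner_add_right, inner_smul_right, inner_sub_right]
    nlinarith
  have hmem : w + t • (z - w) ∈ K := by
    refine h _ ?_ hc'
    rw [add_sub_cancel_left, norm_smul, Real.norm_of_nonneg ht0.le]
    have h1 : t * (‖z - w‖ + 1) ≤ ε / 2 := by
      calc t * (‖z - w‖ + 1) ≤ ε / (‖z - w‖ + 1) / 2 * (‖z - w‖ + 1) := by
            gcongr
            exact min_le_right _ _
        _ = ε / 2 := by field_simp
    nlinarith
  have h2 := hproj _ ⟨hmem, hc'⟩
  rw [add_sub_cancel_left, inner_smul_right] at h2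
  have h3 : ⟪z - w, z - w⟫ ≤ 0 := by
    by_contra! h3
    nlinarith
  rw [real_inner_self_nonpos, sub_eq_zero] at h3
  rw [← h3, hzdef] at hw hwC
  obtain ⟨s, hs, hsK⟩ := exists_one_lt_ray_mem hK hKc hu ho hr hball hw hv.1 hwC
  exact hv.2 s hs hsK

theorem norm_le_of_cap_subset_closedBall (hK : Convex ℝ K) (hKc : IsCompact K)
    (hu : ‖u‖ = 1) (ho : ⟪u, o⟫ = c) (hr : 0 < r) (hrR : r ≤ R)
    (hball : ∀ v, 0 ≤ ⟪u, v⟫ → ‖v‖ ≤ r → o + v ∈ K)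
    (hout : closure (frontier K ∩ {y | c < ⟪u, y⟫}) ⊆ closedBall o R)
    {v : E} (hv : 0 ≤ ⟪u, v⟫) (hvK : o + v ∈ K) : ‖v‖ ≤ R := by
  have hcomp : IsCompact (K ∩ {x | c ≤ ⟪u, x⟫}) :=
    hKc.inter_right (isClosed_le (by fun_prop) (by fun_prop))
  have hmem : ∀ w, 0 ≤ ⟪u, w⟫ → o + w ∈ K → o + w ∈ K ∩ {x | c ≤ ⟪u, x⟫} := fun w h h' =>
    ⟨h', by rw [mem_ofPred_eq, inner_add_right, ho]; linarith⟩
  obtain ⟨w, ⟨hwK, hwc⟩, hmax⟩ := hcomp.exists_isMaxOn ⟨_, hmem v hv hvK⟩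
    (f := fun x => ‖x - o‖) (by fun_prop)
  have hmax' : ∀ y, 0 ≤ ⟪u, y⟫ → o + y ∈ K → ‖y‖ ≤ ‖w - o‖ := fun y hy hyK => by
    simpa using hmax (hmem y hy hyK)
  refine (hmax' v hv hvK).trans ?_
  by_contra! hlt
  have hwo : 0 ≤ ⟪u, w - o⟫ := by
    rw [inner_sub_right, ho]
    linarith [show c ≤ ⟪u, w⟫ from hwc]
  obtain ⟨t, ht, htK⟩ := exists_one_lt_ray_mem hK hKc.isClosed hu ho hr hball (v := w - o)
    (by simpa using hwK) hwo (fun hC => by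
      have := hout hC
      rw [add_sub_cancel, mem_closedBall, dist_eq_norm] at this
      linarith)
  have := hmax' _ (by rw [inner_smul_right]; exact mul_nonneg (by linarith) hwo) htK
  rw [norm_smul, Real.norm_of_nonneg (by linarith)] at this
  nlinarith

theorem mem_outerVectors_of_le_norm (hR : 0 < R)
    (hbound : ∀ v, 0 ≤ ⟪u, v⟫ → o + v ∈ K → ‖v‖ ≤ R) {v : E}
    (hv : 0 ≤ ⟪u, v⟫) (hvR : R ≤ ‖v‖) : v ∈ outerVectors K u o := by
  refine ⟨hv, fun t ht hK => ?_⟩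
  have := hbound _ (by rw [inner_smul_right]; exact mul_nonneg (by linarith) hv) hK
  rw [norm_smul, Real.norm_of_nonneg (by linarith)] at this
  nlinarith

theorem smul_combo_mem_outerVectors_aux (hK : Convex ℝ K) (hr : 0 < r)
    (hball : ∀ v, 0 ≤ ⟪u, v⟫ → ‖v‖ ≤ r → o + v ∈ K) {a b : E} (ha : a ∈ outerVectors K u o)
    (hb : b ∈ outerVectors K u o) (hab : ‖a - b‖ < r) (huab : 0 ≤ ⟪u, a - b⟫) {p q : ℝ}
    (hp : 0 ≤ p) (hq : 0 ≤ q) (hpq : p + q = 1) :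
    (1 - ‖a - b‖ / r)⁻¹ • (p • a + q • b) ∈ outerVectors K u o := by
  set δ := ‖a - b‖ / r with hδ
  have hδ0 : 0 ≤ δ := by positivity
  have hδ1 : 0 < 1 - δ := by
    have : δ < 1 := (div_lt_one hr).2 hab
    linarith
  refine ⟨?_, fun s hs hsK => ?_⟩
  · rw [inner_smul_right, inner_add_right, inner_smul_right, inner_smul_right]
    have := ha.1
    have := hb.1
    positivity
  rw [smul_smul] at hsK
  set k := s * (1 - δ)⁻¹ with hk
  have hk0 : 0 < k := by positivity
  have hkinv : k⁻¹ < 1 - δ := by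
    rw [hk, mul_inv, inv_inv]
    have : s⁻¹ < 1 := inv_lt_one_of_one_lt₀ hs
    nlinarith
  have hkinv0 : 0 < k⁻¹ := by positivity
  rcases hδ0.eq_or_lt with h0 | h0
  · have hab0 : a = b := by
      have : ‖a - b‖ = 0 := by
        rcases div_eq_zero_iff.1 h0.symm with h | h
        · exact h
        · exact absurd h hr.ne'
      rwa [norm_eq_zero, sub_eq_zero] at this
    rw [← hab0, ← add_smul, hpq, one_smul] at hsK
    refine ha.2 k ?_ hsK
    rw [← h0, sub_zero] at hkinv
    exact (inv_lt_one₀ hk0).1 hkinv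
  have hδne := h0.ne'
  have he : o + δ⁻¹ • (a - b) ∈ K := by
    refine hball _ ?_ ?_
    · rw [inner_smul_right]
      positivity
    · rw [norm_smul, norm_inv, Real.norm_of_nonneg hδ0, inv_mul_le_iff₀ h0, hδ]
      exact (div_mul_cancel₀ _ hr.ne').ge
  have hqδ : q * δ ≤ δ := mul_le_of_le_one_left hδ0 (by linarith)
  have hS : 0 < k⁻¹ + q * δ := by positivity
  refine ha.2 (k⁻¹ + q * δ)⁻¹ ((one_lt_inv₀ hS).2 (by linarith)) ?_
  convert hK hsK he (a := k⁻¹ / (k⁻¹ + q * δ)) (b := q * δ / (k⁻¹ + q * δ)) (by positivity)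
    (by positivity) (by field_simp) using 1
  have h1 : a = p • a + q • b + q • (a - b) := by
    have : p = 1 - q := by linarith
    rw [this]
    module
  have h2 : k⁻¹ • k • (p • a + q • b) = p • a + q • b := inv_smul_smul₀ hk0.ne' _
  have h3 : (q * δ) • δ⁻¹ • (a - b) = q • (a - b) := by
    rw [smul_smul, mul_assoc, mul_inv_cancel₀ hδne, mul_one]
  calc o + (k⁻¹ + q * δ)⁻¹ • a
      = ((k⁻¹ + q * δ)⁻¹ * (k⁻¹ + q * δ)) • o
          + (k⁻¹ + q * δ)⁻¹ • (p • a + q • b + q • (a - b)) := by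
        rw [inv_mul_cancel₀ hS.ne', one_smul, ← h1]
    _ = ((k⁻¹ + q * δ)⁻¹ * (k⁻¹ + q * δ)) • o + (k⁻¹ + q * δ)⁻¹ •
          (k⁻¹ • k • (p • a + q • b) + (q * δ) • δ⁻¹ • (a - b)) := by rw [h2, h3]
    _ = _ := by
        rw [div_eq_inv_mul, div_eq_inv_mul]
        module

theorem smul_combo_mem_outerVectors (hK : Convex ℝ K) (hr : 0 < r)
    (hball : ∀ v, 0 ≤ ⟪u, v⟫ → ‖v‖ ≤ r → o + v ∈ K) {a b : E} (ha : a ∈ outerVectors K u o)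
    (hb : b ∈ outerVectors K u o) (hab : ‖a - b‖ < r) {p q : ℝ}
    (hp : 0 ≤ p) (hq : 0 ≤ q) (hpq : p + q = 1) :
    (1 - ‖a - b‖ / r)⁻¹ • (p • a + q • b) ∈ outerVectors K u o := by
  rcases le_total 0 ⟪u, a - b⟫ with h | h
  · exact smul_combo_mem_outerVectors_aux hK hr hball ha hb hab h hp hq hpq
  · rw [norm_sub_rev] at hab ⊢
    rw [add_comm (p • a)]
    refine smul_combo_mem_outerVectors_aux hK hr hball hb ha hab ?_ hq hp (by linarith)
    rw [← neg_sub, inner_neg_right]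
    linarith

end Cap

/-- **Distortion of a nondegenerate cap.** If the cap
`C = cl(∂K ∩ int H⁺)` contains the hemisphere of radius `r` about `o ∈ H` in
its convex hull, and its convex hull lies in the ball of radius `R` about `o`,
then the intrinsic distance in `C` satisfies
`d(x,y) ≤ 4(2+π)(R/r)‖x − y‖`. -/
theorem cap_distortion (d : ℕ) (hd : 2 ≤ d)
    (K : Set (EuclideanSpace ℝ (Fin d))) (hK : IsConvexBodyE K)
    (u : EuclideanSpace ℝ (Fin d)) (c : ℝ) (hu : ‖u‖ = 1)
    (hrel : ∃ x ∈ {y | ⟪u, y⟫ = c} ∩ K, ∃ ε > 0,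
      ball x ε ∩ {y | ⟪u, y⟫ = c} ⊆ K)
    (hintpt : ∃ x ∈ interior K, c < ⟪u, x⟫)
    (C : Set (EuclideanSpace ℝ (Fin d)))
    (hC : C = closure (frontier K ∩ {y | c < ⟪u, y⟫}))
    (o : EuclideanSpace ℝ (Fin d)) (ho : ⟪u, o⟫ = c)
    (r R : ℝ) (hr : 0 < r) (hrR : r ≤ R)
    (hin : {x | c ≤ ⟪u, x⟫ ∧ ‖x - o‖ ≤ r} ⊆ convexHull ℝ C)
    (hout : convexHull ℝ C ⊆ closedBall o R) :
    ∀ x ∈ C, ∀ y ∈ C,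
      intrinsicDist C x y ≤ ENNReal.ofReal (4 * (2 + π) * (R / r) * ‖x - y‖) := by
  subst hC
  set C := closure (frontier K ∩ {y | c < ⟪u, y⟫}) with hCdef
  obtain ⟨hKcomp, hKconv, -⟩ := hK
  have hKc := hKcomp.isClosed
  have hR : 0 < R := hr.trans_le hrR
  have huu : ⟪u, u⟫ = 1 := by rw [real_inner_self_eq_norm_sq, hu, one_pow]
  have hCK : C ⊆ K :=
    closure_minimal (fun y hy => hKc.frontier_subset hy.1) hKc
  have hCc : C ⊆ {x | c ≤ ⟪u, x⟫} :=
    closure_minimal (fun y ⟨_, (hy : c < ⟪u, y⟫)⟩ => hy.le)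
      (isClosed_le (by fun_prop) (by fun_prop))
  have hball : ∀ v, 0 ≤ ⟪u, v⟫ → ‖v‖ ≤ r → o + v ∈ K := fun v h h' =>
    convexHull_min hCK hKconv (hin ⟨by rw [inner_add_right, ho]; linarith, by simpa using h'⟩)
  have hCR : C ⊆ closedBall o R := (subset_convexHull ℝ C).trans hout
  have hbound : ∀ v, 0 ≤ ⟪u, v⟫ → o + v ∈ K → ‖v‖ ≤ R := fun v hv hvK =>
    norm_le_of_cap_subset_closedBall hKconv hKcomp hu ho hr hrR hball hCR hv hvK
  have hMconv : Convex ℝ (K ∩ {x | c ≤ ⟪u, x⟫}) := hKconv.inter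
    (convex_halfSpace_ge (f := fun y => ⟪u, y⟫) (innerₛₗ ℝ u).isLinear c)
  have hoM : o ∈ K ∩ {x | c ≤ ⟪u, x⟫} :=
    ⟨by simpa using hball 0 (by simp) (by simpa using hr.le), ho.ge⟩
  obtain ⟨P, hPlip, hPM, hPid, hPvar⟩ := exists_lipschitz_nearest_point ⟨o, hoM⟩
    (hKc.inter (isClosed_le (by fun_prop) (by fun_prop))) hMconv
  have hPC : ∀ v ∈ outerVectors K u o, P (o + v) ∈ C := fun v hv =>
    nearest_point_mem_cap hKconv hKc hu ho hr hball hv (hPM _).1 (hPM _).2 (hPvar _)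
  have hseg : ∀ v w, segment ℝ v w ⊆ outerVectors K u o →
      intrinsicDist C (P (o + v)) (P (o + w)) ≤ ENNReal.ofReal ‖v - w‖ := by
    intro v w h
    rw [← add_sub_add_left_eq_sub v w o]
    refine intrinsicDist_le_of_segment_mapsTo hPlip ?_
    intro z hz
    rw [← segment_translate_image ℝ o v w] at hz
    obtain ⟨z', hz', rfl⟩ := hz
    exact hPC _ (h hz')
  have hradial : ∀ v ∈ outerVectors K u o, ∀ s : ℝ, 1 ≤ s →
      segment ℝ v (s • v) ⊆ outerVectors K u o := by
    rintro v hv s hs _ ⟨p, q, hp, hq, hpq, rfl⟩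
    rw [smul_smul, ← add_smul]
    exact smul_mem_outerVectors hv (by nlinarith)
  intro x hx y hy
  have hxo := sub_mem_outerVectors_of_mem_cap hKconv ho hr hball hx
  have hyo := sub_mem_outerVectors_of_mem_cap hKconv ho hr hball hy
  have hxR : ‖x - o‖ ≤ R := by simpa [dist_eq_norm] using hCR hx
  have hyR : ‖y - o‖ ≤ R := by simpa [dist_eq_norm] using hCR hy
  have hPx : P (o + (x - o)) = x := by
    rw [add_sub_cancel]
    exact hPid x ⟨hCK hx, hCc hx⟩
  have hPy : P (o + (y - o)) = y := by
    rw [add_sub_cancel]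
    exact hPid y ⟨hCK hy, hCc hy⟩
  have hxy : ‖x - y‖ = ‖(x - o) - (y - o)‖ := by rw [sub_sub_sub_cancel_right]
  rw [hxy]
  conv_lhs => rw [← hPx, ← hPy]
  clear hPx hPy hxy
  generalize x - o = a at *
  generalize y - o = b at *
  have hsub : ∀ (s : ℝ) (v : EuclideanSpace ℝ (Fin d)), (s - 1) • v = s • v - v :=
    fun s v => by rw [sub_smul, one_smul]
  set δ := ‖a - b‖ / r with hδ
  have hδ0 : 0 ≤ δ := by positivity
  have hδr : δ * r = ‖a - b‖ := div_mul_cancel₀ _ hr.ne'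
  have hgoal : 4 * (2 + π) * (R / r) * ‖a - b‖ = 4 * (2 + π) * R * δ := by
    rw [hδ]
    ring
  have hconst : 20 * R * δ ≤ 4 * (2 + π) * R * δ := by
    gcongr
    linarith [Real.pi_gt_three]
  rw [hgoal]
  rcases lt_or_ge δ (1 / 2) with hlt | hge
  · set s := (1 - δ)⁻¹ with hs
    have h1 : 0 < 1 - δ := by linarith
    have hs1 : 1 ≤ s := (one_le_inv₀ h1).2 (by linarith)
    have hs2 : s * (1 - δ) = 1 := inv_mul_cancel₀ h1.ne'
    have hs3 : s ≤ 2 := by nlinarith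
    have hs4 : s - 1 ≤ 2 * δ := by nlinarith
    have hab : ‖a - b‖ < r := by
      rw [← hδr]
      nlinarith
    have hmid : segment ℝ (s • a) (s • b) ⊆ outerVectors K u o := by
      rintro _ ⟨p, q, hp, hq, hpq, rfl⟩
      rw [smul_comm p, smul_comm q, ← smul_add]
      exact smul_combo_mem_outerVectors hKconv hr hball hxo hyo hab hp hq hpq
    have hna : ‖a - s • a‖ = (s - 1) * ‖a‖ := by
      rw [norm_sub_rev, ← hsub, norm_smul, Real.norm_of_nonneg (by linarith)]
    have hnb : ‖s • b - b‖ = (s - 1) * ‖b‖ := by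
      rw [← hsub, norm_smul, Real.norm_of_nonneg (by linarith)]
    have hnm : ‖s • a - s • b‖ = s * (δ * r) := by
      rw [← smul_sub, norm_smul, Real.norm_of_nonneg (by linarith), hδr]
    have e1 := hseg a (s • a) (hradial a hxo s hs1)
    have e2 := hseg (s • a) (s • b) hmid
    have e3 := hseg (s • b) b (segment_symm ℝ b (s • b) ▸ hradial b hyo s hs1)
    refine (intrinsicDist_triangle.trans (add_le_add e1
      (intrinsicDist_triangle.trans (add_le_add e2 e3)))).trans ?_
    rw [← ENNReal.ofReal_add (norm_nonneg _) (norm_nonneg _),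
      ← ENNReal.ofReal_add (norm_nonneg _) (by positivity), hna, hnb, hnm]
    refine ENNReal.ofReal_le_ofReal (le_trans ?_ hconst)
    have f1 : (s - 1) * ‖a‖ ≤ 2 * δ * R := by gcongr
    have f2 : (s - 1) * ‖b‖ ≤ 2 * δ * R := by gcongr
    have f3 : s * (δ * r) ≤ 2 * (δ * R) := by gcongr
    nlinarith [mul_nonneg hδ0 hR.le]
  · have hout' : ∀ v, 0 ≤ ⟪u, v⟫ → R ≤ ‖v‖ → v ∈ outerVectors K u o := fun v hv hvR =>
      mem_outerVectors_of_le_norm hR hbound hv hvR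
    have hup : ∀ v ∈ outerVectors K u o, ‖v‖ ≤ R → ∃ w, ‖w‖ = R ∧ R ≤ ⟪u, w + R • u⟫ ∧
        ‖v - w‖ ≤ R ∧ segment ℝ v w ⊆ outerVectors K u o ∧
        segment ℝ w (w + R • u) ⊆ outerVectors K u o := by
      intro v hv hvR
      have hv0 : 0 < ‖v‖ := by
        refine norm_pos_iff.2 fun h => ?_
        refine hv.2 2 (by norm_num) ?_
        rw [h, smul_zero, add_zero]
        exact hoM.1
      have hk : 1 ≤ R / ‖v‖ := (one_le_div hv0).2 hvR
      have hw : ‖(R / ‖v‖) • v‖ = R := by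
        rw [norm_smul, Real.norm_of_nonneg (by linarith), div_mul_cancel₀ _ hv0.ne']
      have hwu : 0 ≤ ⟪u, (R / ‖v‖) • v⟫ := (smul_mem_outerVectors hv hk).1
      refine ⟨(R / ‖v‖) • v, hw, ?_, ?_, hradial v hv _ hk, ?_⟩
      · rw [inner_add_right, inner_smul_right u u, huu]
        linarith
      · rw [norm_sub_rev, ← hsub, norm_smul, Real.norm_of_nonneg (by linarith), sub_mul,
          div_mul_cancel₀ _ hv0.ne']
        linarith
      · generalize (R / ‖v‖) • v = w at *
        rintro _ ⟨p, q, hp, hq, hpq, rfl⟩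
        have he : p • w + q • (w + R • u) = w + (q * R) • u := by
          rw [smul_add, ← add_assoc, ← add_smul, hpq, one_smul, smul_smul]
        have hqR : 0 ≤ q * R := by positivity
        rw [he]
        refine hout' _ ?_ ?_
        · rw [inner_add_right, inner_smul_right, huu]
          linarith
        · refine le_of_sq_le_sq ?_ (norm_nonneg _)
          rw [norm_add_sq_real, hw, inner_smul_right, real_inner_comm]
          nlinarith [mul_nonneg hqR hwu, sq_nonneg ‖(q * R) • u‖]
    obtain ⟨a', ha', hau, haa', hsa, hsa'⟩ := hup a hxo hxR
    obtain ⟨b', hb', hbu, hbb', hsb, hsb'⟩ := hup b hyo hyR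
    have hmid : segment ℝ (a' + R • u) (b' + R • u) ⊆ outerVectors K u o := by
      rintro _ ⟨p, q, hp, hq, hpq, rfl⟩
      have h1 : R ≤ ⟪u, p • (a' + R • u) + q • (b' + R • u)⟫ := by
        rw [inner_add_right, inner_smul_right, inner_smul_right]
        nlinarith [mul_le_mul_of_nonneg_left hau hp, mul_le_mul_of_nonneg_left hbu hq]
      refine hout' _ (hR.le.trans h1) (h1.trans ?_)
      simpa [hu] using real_inner_le_norm u (p • (a' + R • u) + q • (b' + R • u))
    have hRu : ‖R • u‖ = R := by rw [norm_smul, hu, mul_one, Real.norm_of_nonneg hR.le]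
    have e1 := hseg a a' hsa
    have e2 := hseg a' (a' + R • u) hsa'
    have e3 := hseg (a' + R • u) (b' + R • u) hmid
    have e4 := hseg (b' + R • u) b' (segment_symm ℝ b' (b' + R • u) ▸ hsb')
    have e5 := hseg b' b (segment_symm ℝ b b' ▸ hsb)
    refine (intrinsicDist_triangle.trans (add_le_add e1 (intrinsicDist_triangle.trans
      (add_le_add e2 (intrinsicDist_triangle.trans (add_le_add e3
      (intrinsicDist_triangle.trans (add_le_add e4 e5)))))))).trans ?_
    rw [← ENNReal.ofReal_add (by positivity) (by positivity),
      ← ENNReal.ofReal_add (by positivity) (by positivity),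
      ← ENNReal.ofReal_add (by positivity) (by positivity),
      ← ENNReal.ofReal_add (by positivity) (by positivity)]
    refine ENNReal.ofReal_le_ofReal ?_
    rw [sub_add_cancel_left, norm_neg, add_sub_cancel_left, hRu, add_sub_add_right_eq_sub,
      norm_sub_rev b' b]
    have h3 : ‖a' - b'‖ ≤ 2 * R := by linarith [norm_sub_le a' b']
    have hδR : 0 ≤ (δ - 1 / 2) * R := mul_nonneg (by linarith) hR.le
    linarith
end
end

section
/- Let K ⊆ ℝ³ be a convex body and p ∈ ∂K. Then there exists ε > 0 such that for every r with 0 < r ≤ ε, the set D := {x ∈ ∂K : ‖x − p‖ ≤ r} is a topological disk meeting the sphere of radius r about p exactly in its boundary circle: there is a homeomorphism from the closed unit disk {y ∈ ℝ² : ‖y‖ ≤ 1} onto D which maps the unit circle {y ∈ ℝ² : ‖y‖ = 1} onto {x ∈ D : ‖x − p‖ = r}. -/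
open Set Metric

noncomputable section

abbrev E3 : Type := EuclideanSpace ℝ (Fin 3)

/-- A convex body in ℝ³. -/
def IsConvexBody (K : Set E3) : Prop :=
  IsCompact K ∧ Convex ℝ K ∧ (interior K).Nonempty

/-- The closed unit disk in ℝ². -/
def discM : Set (ℝ × ℝ) := {x | x.1 ^ 2 + x.2 ^ 2 ≤ 1}

/-- The unit circle in ℝ². -/
def bdryM : Set (ℝ × ℝ) := {x | x.1 ^ 2 + x.2 ^ 2 = 1}

/-- Sub-convex combinations of a point of `K` and an interior point are interior if `0 ∈ K`. -/
theorem Convex.smul_add_smul_mem_interior {E : Type*} [NormedAddCommGroup E] [NormedSpace ℝ E]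
    {K : Set E} (hK : Convex ℝ K) (h0 : (0 : E) ∈ K) {x y : E} (hx : x ∈ K)
    (hy : y ∈ interior K) {a b : ℝ} (ha : 0 ≤ a) (hb : 0 < b) (hab : a + b ≤ 1) :
    a • x + b • y ∈ interior K := by
  rcases eq_or_lt_of_le (show b ≤ 1 by linarith) with h1 | h1
  · obtain rfl : a = 0 := by linarith
    simpa [h1] using hy
  · have h2 : 0 < 1 - b := by linarith
    have hx' : (a / (1 - b)) • x ∈ K :=
      hK.smul_mem_of_zero_mem h0 hx ⟨by positivity, by rw [div_le_one h2]; linarith⟩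
    have := hK.combo_self_interior_mem_interior hx' hy h2.le hb (by ring)
    rwa [smul_smul, mul_div_cancel₀ _ h2.ne'] at this

/-- The unit directions of points of `K`, tilted by an interior direction `e`, point uniformly
into the interior of `K`. -/
theorem Convex.exists_forall_smul_direction_add_mem_interior {E : Type*} [NormedAddCommGroup E]
    [NormedSpace ℝ E] [ProperSpace E] {K : Set E} (hK : Convex ℝ K) (h0 : (0 : E) ∈ K) {e : E}
    (he : e ∈ interior K) :
    ∃ T : ℝ, 0 < T ∧ ∀ x ∈ K, x ≠ 0 → T • (‖x‖⁻¹ • x + e) ∈ interior K := by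
  set A : Set E := (fun x => ‖x‖⁻¹ • x) '' (K \ {0}) with hA
  have hAc : IsCompact (closure A) := by
    refine (isCompact_closedBall (0 : E) 1).closure_of_subset ?_
    rintro _ ⟨x, hx, rfl⟩
    have : ‖x‖ ≠ 0 := norm_ne_zero_iff.2 hx.2
    simp [norm_smul, this]
  let U : ℕ → Set E := fun n => {w | (1 / ((n : ℝ) + 1)) • (w + e) ∈ interior K}
  have hUo : ∀ n, IsOpen (U n) := fun n =>
    isOpen_interior.preimage (by fun_prop : Continuous fun w : E => (1 / ((n : ℝ) + 1)) • (w + e))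
  have hmono : Monotone U := by
    intro m n hmn w hw
    have hm : (0 : ℝ) < m + 1 := by positivity
    have hn : (0 : ℝ) < n + 1 := by positivity
    have hmn' : (m : ℝ) ≤ n := by exact_mod_cast hmn
    have := hK.smul_add_smul_mem_interior h0 h0 hw le_rfl
      (b := ((m : ℝ) + 1) / (n + 1)) (by positivity)
      (by rw [zero_add, div_le_one hn]; linarith)
    have h : ((m : ℝ) + 1) / (n + 1) * (1 / (m + 1)) = 1 / (n + 1) := by field_simp
    rwa [smul_zero, zero_add, smul_smul, h] at this
  have hcover : closure A ⊆ ⋃ n, U n := by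
    intro w hw
    obtain ⟨δ, hδ, hball⟩ := Metric.isOpen_iff.1 isOpen_interior e he
    obtain ⟨_, ⟨x, hx, rfl⟩, hxw⟩ := Metric.mem_closure_iff.1 hw δ hδ
    have hxpos : 0 < ‖x‖ := norm_pos_iff.2 hx.2
    have hy : e + (w - ‖x‖⁻¹ • x) ∈ interior K := by
      apply hball
      rw [mem_ball, dist_eq_norm, add_sub_cancel_left, ← dist_eq_norm]
      exact hxw
    obtain ⟨n, hn⟩ := exists_nat_gt (‖x‖⁻¹)
    have hn' : (0 : ℝ) < n + 1 := by positivity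
    refine mem_iUnion.2 ⟨n, ?_⟩
    have := hK.smul_add_smul_mem_interior h0 hx.1 hy
      (a := 1 / ((n : ℝ) + 1) * ‖x‖⁻¹) (b := 1 / ((n : ℝ) + 1))
      (by positivity) (by positivity) (by
        rw [← mul_add_one, one_div, inv_mul_le_one₀ hn']; linarith)
    change (1 / ((n : ℝ) + 1)) • (w + e) ∈ interior K
    convert this using 1
    module
  obtain ⟨n, hn⟩ := hAc.elim_directed_cover U hUo hcover hmono.directed_le
  exact ⟨1 / ((n : ℝ) + 1), by positivity, fun x hx hx0 =>
    hn (subset_closure ⟨x, ⟨hx, hx0⟩, rfl⟩)⟩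

/-- Near a frontier point `0` of a convex set, every small sphere meets the set in a region that is
star-shaped, along arcs of the sphere, around an interior direction `e`. -/
theorem Convex.exists_star_direction {E : Type*} [NormedAddCommGroup E]
    [NormedSpace ℝ E] [ProperSpace E] {K : Set E} (hK : Convex ℝ K) (hKc : IsClosed K)
    (hKi : (interior K).Nonempty) (h0 : (0 : E) ∈ frontier K) :
    ∃ e : E, e ≠ 0 ∧ ∃ ε > 0, (∀ j : ℝ, 0 < j → j * ‖e‖ ≤ ε → j • e ∈ interior K) ∧
      (∀ j : ℝ, j < 0 → j • e ∉ K) ∧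
      ∀ x ∈ K, x ≠ 0 → ‖x‖ ≤ ε → ∀ a b : ℝ, 0 < a → 0 < b → ‖a • x + b • e‖ = ‖x‖ →
        a • x + b • e ∈ interior K := by
  have h0K : (0 : E) ∈ K := hKc.frontier_subset h0
  have h0i : (0 : E) ∉ interior K := h0.2
  obtain ⟨q, hq⟩ := hKi
  obtain ⟨e, he, hehalf⟩ : ∃ e ∈ interior K, ‖e‖ ≤ 1 / 2 := by
    have hpos : 0 < 1 / (2 * (‖q‖ + 1)) := by positivity
    refine ⟨(1 / (2 * (‖q‖ + 1))) • q, ?_, ?_⟩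
    · have := hK.smul_add_smul_mem_interior h0K h0K hq le_rfl hpos (by
        rw [zero_add, div_le_one (by positivity)]; linarith [norm_nonneg q])
      simpa using this
    · rw [norm_smul, Real.norm_of_nonneg hpos.le, div_mul_eq_mul_div, one_mul,
        div_le_div_iff₀ (by positivity) (by norm_num)]
      linarith
  have he0 : e ≠ 0 := fun h => h0i (h ▸ he)
  have hepos : 0 < ‖e‖ := norm_pos_iff.2 he0
  obtain ⟨T, hT, hTK⟩ := hK.exists_forall_smul_direction_add_mem_interior h0K he
  obtain ⟨f, hf⟩ := geometric_hahn_banach_open_point hK.interior isOpen_interior h0i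
  rw [map_zero] at hf
  have hfe := hf e he
  have hfK : ∀ x ∈ K, f x ≤ 0 := by
    intro x hx
    have h1 : x ∈ closure (interior K) := by
      rw [hK.closure_interior_eq_closure_of_nonempty_interior ⟨e, he⟩]
      exact subset_closure hx
    exact closure_minimal (fun y hy => (hf y hy).le)
      (isClosed_le f.continuous continuous_const) h1
  set B := ‖f‖ / (-f e) with hB
  have hfe' : 0 < -f e := by linarith
  have hB0 : 0 ≤ B := by positivity
  have hden : 0 < (1 + B) / T + B + 1 := by positivity
  refine ⟨e, he0, min (min (T / 2) ‖e‖) (1 / ((1 + B) / T + B + 1)), by positivity, ?_, ?_, ?_⟩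
  · intro j hj hje
    have h1 : j * ‖e‖ ≤ ‖e‖ := hje.trans ((min_le_left _ _).trans (min_le_right _ _))
    have h2 : j ≤ 1 := by nlinarith
    simpa using hK.smul_add_smul_mem_interior h0K h0K he le_rfl hj (by linarith)
  · intro j hj hjK
    have := hfK _ hjK
    rw [map_smul, smul_eq_mul] at this
    nlinarith
  · intro x hx hx0 hxε a b ha hb hnorm
    set s := ‖x‖ with hs
    have hspos : 0 < s := norm_pos_iff.2 hx0
    have hsT : s ≤ T / 2 := hxε.trans ((min_le_left _ _).trans (min_le_left _ _))
    have hsB : s * ((1 + B) / T + B + 1) ≤ 1 := by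
      rw [← le_div_iff₀ hden]; exact hxε.trans (min_le_right _ _)
    have hz := hTK x hx hx0
    set β := b / s with hβ
    have hβpos : 0 < β := by positivity
    have hbs : b = s * β := by rw [hβ]; field_simp
    have hβB : β ≤ B := by
      have h1 : -f (a • x + b • e) ≤ ‖f‖ * s := by
        rw [← hnorm]
        exact (neg_le_abs _).trans (f.le_opNorm _)
      rw [map_add, map_smul, map_smul, smul_eq_mul, smul_eq_mul] at h1
      have h2 := mul_nonneg ha.le (neg_nonneg.2 (hfK x hx))
      rw [hB, le_div_iff₀ hfe', ← mul_le_mul_iff_right₀ hspos]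
      rw [hbs] at h1
      nlinarith
    have haβ : a ≤ 1 + β / 2 := by
      have h1 : ‖a • x‖ ≤ ‖a • x + b • e‖ + ‖b • e‖ := by
        simpa using norm_sub_le (a • x + b • e) (b • e)
      rw [hnorm, norm_smul, norm_smul, Real.norm_of_nonneg ha.le, Real.norm_of_nonneg hb.le,
        ← hs] at h1
      have h2 : b * ‖e‖ ≤ b * (1 / 2) := by gcongr
      rw [← mul_le_mul_iff_right₀ hspos]
      rw [hbs] at h1 h2
      nlinarith
    have hsT' : s / T ≤ 1 / 2 := by rw [div_le_iff₀ hT]; linarith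
    rcases le_or_gt β a with hle | hlt
    · have := hK.smul_add_smul_mem_interior h0K hx hz (a := a - β) (b := s / T * β)
        (by linarith) (by positivity) (by nlinarith)
      convert this using 1
      rw [hbs, ← hs]
      match_scalars <;> field_simp
      ring
    · have := hK.smul_add_smul_mem_interior h0K (interior_subset hz) he (a := s / T * a)
        (b := s * (β - a)) (by positivity) (mul_pos hspos (by linarith)) (by
          have h3 : s / T * a ≤ s / T * (1 + B) := by
            gcongr; linarith
          have h4 : s * (β - a) ≤ s * B := by
            gcongr; linarith
          have h5 : s * ((1 + B) / T + B + 1) = s / T * (1 + B) + s * B + s := by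
            field_simp
          linarith)
      convert this using 1
      rw [hbs, ← hs]
      match_scalars <;> field_simp
      ring

/-- A continuous bijection from a compact set has a continuous inverse. -/
theorem IsCompact.continuousOn_invOn {X Y : Type*} [TopologicalSpace X] [TopologicalSpace Y]
    [T2Space Y] {f : X → Y} {g : Y → X} {s : Set X} {t : Set Y} (hs : IsCompact s)
    (hf : ContinuousOn f s) (hts : MapsTo g t s) (hfg : InvOn g f s t) :
    ContinuousOn g t := by
  rw [continuousOn_iff_isClosed]
  intro c hc
  refine ⟨f '' (s ∩ c), ((hs.inter_right hc).image_of_continuousOn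
    (hf.mono inter_subset_left)).isClosed, ?_⟩
  ext y
  constructor
  · rintro ⟨hyc, hy⟩
    exact ⟨⟨g y, ⟨hts hy, hyc⟩, hfg.2 hy⟩, hy⟩
  · rintro ⟨⟨x, ⟨hx, hxc⟩, rfl⟩, hy⟩
    exact ⟨by rwa [mem_preimage, hfg.1 hx], hy⟩

/-- The Euclidean norm on `ℝ × ℝ`. -/
def euclNorm (y : ℝ × ℝ) : ℝ := √(y.1 ^ 2 + y.2 ^ 2)

theorem continuous_euclNorm : Continuous euclNorm := by
  unfold euclNorm; fun_prop

theorem euclNorm_sq (y : ℝ × ℝ) : euclNorm y ^ 2 = y.1 ^ 2 + y.2 ^ 2 :=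
  Real.sq_sqrt (by positivity)

theorem euclNorm_nonneg (y : ℝ × ℝ) : 0 ≤ euclNorm y := Real.sqrt_nonneg _

theorem euclNorm_smul (c : ℝ) (hc : 0 ≤ c) (y : ℝ × ℝ) : euclNorm (c • y) = c * euclNorm y := by
  have : (c • y).1 ^ 2 + (c • y).2 ^ 2 = c ^ 2 * (y.1 ^ 2 + y.2 ^ 2) := by
    simp only [Prod.smul_fst, Prod.smul_snd, smul_eq_mul]; ring
  rw [euclNorm, this, Real.sqrt_mul (sq_nonneg c), Real.sqrt_sq hc, euclNorm]

theorem norm_le_euclNorm (y : ℝ × ℝ) : ‖y‖ ≤ euclNorm y :=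
  max_le (Real.abs_le_sqrt (by nlinarith [sq_nonneg y.2]))
    (Real.abs_le_sqrt (by nlinarith [sq_nonneg y.1]))

theorem euclNorm_pos {y : ℝ × ℝ} (hy : y ≠ 0) : 0 < euclNorm y :=
  (norm_pos_iff.2 hy).trans_le (norm_le_euclNorm y)

theorem mem_discM_iff (y : ℝ × ℝ) : y ∈ discM ↔ euclNorm y ≤ 1 := by
  rw [← sq_le_one_iff₀ (euclNorm_nonneg y), euclNorm_sq]; rfl

theorem mem_bdryM_iff (y : ℝ × ℝ) : y ∈ bdryM ↔ euclNorm y = 1 := by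
  rw [← pow_eq_one_iff_of_nonneg (euclNorm_nonneg y) two_ne_zero, euclNorm_sq]; rfl

theorem exists_linearMap_ker_eq_span {e : E3} (he : e ≠ 0) :
    ∃ P : E3 →ₗ[ℝ] ℝ × ℝ, Function.Surjective P ∧ ∀ x, P x = 0 ↔ ∃ j : ℝ, j • e = x := by
  have h1 : Module.finrank ℝ (E3 ⧸ Submodule.span ℝ {e}) = Module.finrank ℝ (ℝ × ℝ) := by
    have h2 := Submodule.finrank_quotient_add_finrank (Submodule.span ℝ {e})
    rw [finrank_span_singleton he] at h2
    simp at h2 ⊢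
    omega
  let F := LinearEquiv.ofFinrankEq _ _ h1
  refine ⟨F.toLinearMap ∘ₗ (Submodule.span ℝ {e}).mkQ,
    F.surjective.comp (Submodule.mkQ_surjective _), fun x => ?_⟩
  simp [Submodule.mem_span_singleton]

/-- Keeps the distance to the origin (divided by `r`), takes the direction from `P`. -/
def polarProj (P : E3 → ℝ × ℝ) (r : ℝ) (x : E3) : ℝ × ℝ := (‖x‖ / r / euclNorm (P x)) • P x

theorem euclNorm_polarProj {P : E3 →ₗ[ℝ] ℝ × ℝ} {r : ℝ} (hr : 0 < r) {x : E3}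
    (hx : x = 0 ∨ P x ≠ 0) : euclNorm (polarProj P r x) = ‖x‖ / r := by
  have h : 0 ≤ ‖x‖ / r / euclNorm (P x) := by have := euclNorm_nonneg (P x); positivity
  rw [polarProj, euclNorm_smul _ h]
  rcases hx with rfl | hx
  · simp
  · exact div_mul_cancel₀ _ (euclNorm_pos hx).ne'

theorem continuousOn_polarProj (P : E3 →ₗ[ℝ] ℝ × ℝ) {r : ℝ} (hr : 0 < r) :
    ContinuousOn (polarProj P r) {x | x = 0 ∨ P x ≠ 0} := by
  have hP : Continuous P := P.continuous_of_finiteDimensional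
  intro x hx
  by_cases hx0 : x = 0
  · subst hx0
    have h0 : polarProj P r 0 = 0 := by simp [polarProj]
    rw [ContinuousWithinAt, h0]
    refine squeeze_zero_norm' (a := fun x : E3 => ‖x‖ / r) ?_ ?_
    · filter_upwards [self_mem_nhdsWithin] with y hy
      exact (norm_le_euclNorm _).trans (euclNorm_polarProj hr hy).le
    · have : Continuous fun x : E3 => ‖x‖ / r := by fun_prop
      simpa using (this.tendsto 0).mono_left nhdsWithin_le_nhds
  · have hPx : P x ≠ 0 := hx.resolve_left hx0
    apply ContinuousAt.continuousWithinAt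
    have h1 : ContinuousAt (fun x => euclNorm (P x)) x :=
      (continuous_euclNorm.comp hP).continuousAt
    exact (((continuous_norm.continuousAt).div_const r).div h1
      (euclNorm_pos hPx).ne').smul hP.continuousAt

/-- The statement for the frontier point `0`. -/
theorem small_ball_at_zero (K : Set E3) (hK : IsConvexBody K) (h0 : (0 : E3) ∈ frontier K) :
    ∃ ε > 0, ∀ r : ℝ, 0 < r → r ≤ ε →
      ∃ φ : (ℝ × ℝ) → E3,
        ContinuousOn φ discM ∧ Set.InjOn φ discM ∧
        φ '' discM = frontier K ∩ closedBall 0 r ∧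
        φ '' bdryM = {x ∈ frontier K ∩ closedBall 0 r | ‖x‖ = r} := by
  obtain ⟨hKcomp, hKconv, hKi⟩ := hK
  have hKc := hKcomp.isClosed
  obtain ⟨e, he0, ε, hε, hpos, hneg, hstar⟩ := hKconv.exists_star_direction hKc hKi h0
  have hepos : 0 < ‖e‖ := norm_pos_iff.2 he0
  obtain ⟨P, hPsurj, hPker⟩ := exists_linearMap_ker_eq_span he0
  have hPe : P e = 0 := (hPker e).2 ⟨1, one_smul _ _⟩
  refine ⟨ε, hε, fun r hr hrε => ?_⟩
  set D : Set E3 := frontier K ∩ closedBall 0 r with hD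
  have hDcomp : IsCompact D :=
    (hKcomp.of_isClosed_subset isClosed_frontier hKc.frontier_subset).inter_right isClosed_closedBall
  have hDnorm : ∀ x ∈ D, ‖x‖ ≤ r := fun x hx => by simpa using hx.2
  have hDK : ∀ x ∈ D, x ∈ K := fun x hx => hKc.frontier_subset hx.1
  have hDP : ∀ x ∈ D, x = 0 ∨ P x ≠ 0 := by
    intro x hx
    by_contra! h
    obtain ⟨j, rfl⟩ := (hPker x).1 h.2
    rcases lt_trichotomy j 0 with hj | rfl | hj
    · exact hneg j hj (hDK _ hx)
    · simp at h
    · refine hx.1.2 (hpos j hj ?_)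
      have := hDnorm _ hx
      rw [norm_smul, Real.norm_of_nonneg hj.le] at this
      exact this.trans hrε
  have hcont : ContinuousOn (polarProj P r) D := (continuousOn_polarProj P hr).mono hDP
  have hmaps : MapsTo (polarProj P r) D discM := by
    intro x hx
    rw [mem_discM_iff, euclNorm_polarProj hr (hDP x hx), div_le_one hr]
    exact hDnorm x hx
  have hinj : InjOn (polarProj P r) D := by
    intro x hx y hy hxy
    have hn : ‖x‖ = ‖y‖ := by
      have := congrArg euclNorm hxy
      rw [euclNorm_polarProj hr (hDP x hx), euclNorm_polarProj hr (hDP y hy)] at this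
      exact (div_left_inj' hr.ne').1 this
    by_cases hx0 : x = 0
    · rw [hx0, norm_zero] at hn
      rw [hx0, norm_eq_zero.1 hn.symm]
    have hxn : 0 < ‖x‖ := norm_pos_iff.2 hx0
    have hy0 : y ≠ 0 := norm_pos_iff.1 (hn ▸ hxn)
    have hPx := euclNorm_pos ((hDP x hx).resolve_left hx0)
    have hPy := euclNorm_pos ((hDP y hy).resolve_left hy0)
    set k := euclNorm (P x) / euclNorm (P y) with hk
    have hkpos : 0 < k := by positivity
    have hPxy : P x = k • P y := by
      have h := congrArg (fun z => (euclNorm (P x) * r / ‖x‖) • z) hxy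
      simp only [polarProj, smul_smul] at h
      rw [← hn] at h
      have h1 : euclNorm (P x) * r / ‖x‖ * (‖x‖ / r / euclNorm (P x)) = 1 := by field_simp
      have h2 : euclNorm (P x) * r / ‖x‖ * (‖x‖ / r / euclNorm (P y)) = k := by
        rw [hk]; field_simp
      rwa [h1, h2, one_smul] at h
    obtain ⟨j, hj⟩ := (hPker (x - k • y)).1 (by rw [map_sub, map_smul, hPxy, sub_self])
    have hxj : x = k • y + j • e := by rw [hj]; abel
    rcases lt_trichotomy j 0 with hj0 | rfl | hj0
    · exfalso
      have hyj : y = k⁻¹ • x + (-j * k⁻¹) • e := by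
        rw [hxj]
        match_scalars <;> field_simp
        ring
      refine hy.1.2 ?_
      rw [hyj]
      exact hstar x (hDK x hx) hx0 ((hDnorm x hx).trans hrε) _ _ (by positivity)
        (mul_pos (by linarith) (by positivity)) (by rw [← hyj, hn])
    · rw [zero_smul, add_zero] at hxj
      have h1 : ‖y‖ = k * ‖y‖ := by
        rw [← hn, hn]
        nth_rewrite 1 [← hn]
        rw [hxj, norm_smul, Real.norm_of_nonneg hkpos.le]
      have h2 : k = 1 := by
        have := norm_pos_iff.2 hy0
        nlinarith
      rw [hxj, h2, one_smul]
    · exfalso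
      refine hx.1.2 ?_
      rw [hxj]
      exact hstar y (hDK y hy) hy0 ((hDnorm y hy).trans hrε) _ _ hkpos hj0 (by rw [← hxj, hn])
  have hsurj : SurjOn (polarProj P r) D discM := by
    intro y hy
    by_cases hy0 : y = 0
    · exact ⟨0, ⟨h0, by simp [hr.le]⟩, by simp [polarProj, hy0]⟩
    have hNy := euclNorm_pos hy0
    rw [mem_discM_iff] at hy
    obtain ⟨v, hv⟩ := hPsurj y
    set s := r * euclNorm y with hs
    have hspos : 0 < s := by positivity
    have hsr : s ≤ r := by nlinarith
    let u : ℝ → E3 := fun t => Real.cos t • e + Real.sin t • v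
    have hPu : ∀ t, P (u t) = Real.sin t • y := by
      intro t; simp only [u, map_add, map_smul, hPe, hv, smul_zero, zero_add]
    have hu : ∀ t, u t ≠ 0 := by
      intro t ht
      have h1 := hPu t
      rw [ht, map_zero] at h1
      have h2 : Real.sin t = 0 := (smul_eq_zero.1 h1.symm).resolve_right hy0
      have h3 : Real.cos t = 0 := by
        simp only [u, h2, zero_smul, add_zero] at ht
        exact (smul_eq_zero.1 ht).resolve_right he0
      have := Real.sin_sq_add_cos_sq t
      simp [h2, h3] at this
    have hun : ∀ t, 0 < ‖u t‖ := fun t => norm_pos_iff.2 (hu t)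
    let γ : ℝ → E3 := fun t => (s / ‖u t‖) • u t
    have hucont : Continuous u := by fun_prop
    have hγ : Continuous γ :=
      (continuous_const.div hucont.norm fun t => (hun t).ne').smul hucont
    have hγn : ∀ t, ‖γ t‖ = s := by
      intro t
      rw [norm_smul, Real.norm_of_nonneg (by positivity), div_mul_cancel₀ _ (hun t).ne']
    have hγ0 : γ 0 ∈ interior K := by
      have h : γ 0 = (s / ‖e‖) • e := by simp [γ, u]
      rw [h]
      exact hpos _ (by positivity) (by rw [div_mul_cancel₀ _ hepos.ne']; linarith)
    have hγπ : γ Real.pi ∉ K := by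
      have h : γ Real.pi = (-(s / ‖e‖)) • e := by simp [γ, u]
      rw [h]
      exact hneg _ (by rw [neg_lt_zero]; positivity)
    have hpre : IsPreconnected (γ '' Icc 0 Real.pi) :=
      isPreconnected_Icc.image _ hγ.continuousOn
    obtain ⟨t, ht, htf⟩ : ∃ t ∈ Icc 0 Real.pi, γ t ∈ frontier K := by
      by_contra! h
      obtain ⟨z, -, hzi, hzc⟩ := hpre _ _ isOpen_interior hKc.isOpen_compl
        (by
          rintro _ ⟨t, ht, rfl⟩
          by_contra hn
          rw [mem_union, mem_compl_iff, not_or, not_not] at hn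
          exact h t ht ⟨subset_closure hn.2, hn.1⟩)
        ⟨γ 0, ⟨0, ⟨le_rfl, Real.pi_pos.le⟩, rfl⟩, hγ0⟩
        ⟨γ Real.pi, ⟨Real.pi, ⟨Real.pi_pos.le, le_rfl⟩, rfl⟩, hγπ⟩
      exact hzc (interior_subset hzi)
    have ht0 : 0 < t := lt_of_le_of_ne ht.1 (by rintro rfl; exact htf.2 hγ0)
    have htπ : t < Real.pi :=
      lt_of_le_of_ne ht.2 (by rintro rfl; exact hγπ (hKc.frontier_subset htf))
    have hsin := Real.sin_pos_of_pos_of_lt_pi ht0 htπ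
    refine ⟨γ t, ⟨htf, by simpa [hγn] using hsr⟩, ?_⟩
    have hPγ : P (γ t) = (s / ‖u t‖ * Real.sin t) • y := by
      simp only [γ, map_smul, hPu, smul_smul]
    have hc : 0 < s / ‖u t‖ * Real.sin t := by have := hun t; positivity
    rw [polarProj, hPγ, hγn, euclNorm_smul _ hc.le, smul_smul]
    generalize s / ‖u t‖ * Real.sin t = c at hc
    have : s / r / (c * euclNorm y) * c = 1 := by rw [hs]; field_simp
    rw [this, one_smul]
  have hbij : BijOn (polarProj P r) D discM := ⟨hmaps, hinj, hsurj⟩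
  have hinv := hbij.invOn_invFunOn
  set φ := Function.invFunOn (polarProj P r) D with hφ
  have hφbij : BijOn φ discM D := hbij.symm hinv.symm
  refine ⟨φ, hDcomp.continuousOn_invOn hcont hφbij.mapsTo hinv, hφbij.injOn,
    hφbij.image_eq, ?_⟩
  have hb : ∀ x ∈ D, polarProj P r x ∈ bdryM ↔ ‖x‖ = r := by
    intro x hx
    rw [mem_bdryM_iff, euclNorm_polarProj hr (hDP x hx), div_eq_one_iff_eq hr.ne']
  have hsub : bdryM ⊆ discM := fun y hy => (show _ = _ from hy).le
  ext x
  constructor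
  · rintro ⟨y, hy, rfl⟩
    refine ⟨hφbij.mapsTo (hsub hy), (hb _ (hφbij.mapsTo (hsub hy))).1 ?_⟩
    rwa [hinv.2 (hsub hy)]
  · rintro ⟨hx, hxr⟩
    exact ⟨polarProj P r x, (hb x hx).2 hxr, hinv.1 hx⟩

/-- For a convex body `K` and `p ∈ ∂K`, for all sufficiently small `r > 0` the
set `D = ∂K ∩ closedBall p r` is a topological disk whose boundary circle is
exactly `D ∩ sphere p r`: there is a homeomorphism of the closed unit disk
onto `D` carrying the unit circle onto `{x ∈ D : ‖x − p‖ = r}`. -/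
theorem small_ball_on_convex_boundary_is_disk
    (K : Set E3) (hK : IsConvexBody K) (p : E3) (hp : p ∈ frontier K) :
    ∃ ε > 0, ∀ r : ℝ, 0 < r → r ≤ ε →
      ∃ φ : (ℝ × ℝ) → E3,
        ContinuousOn φ discM ∧ Set.InjOn φ discM ∧
        φ '' discM = frontier K ∩ closedBall p r ∧
        φ '' bdryM = {x ∈ frontier K ∩ closedBall p r | ‖x - p‖ = r} := by
  let h : E3 ≃ₜ E3 := Homeomorph.addRight p
  have hf : frontier (h ⁻¹' K) = h ⁻¹' frontier K := (h.preimage_frontier K).symm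
  have hbody : IsConvexBody (h ⁻¹' K) := by
    refine ⟨h.isCompact_preimage.2 hK.1, hK.2.1.translate_preimage_left p, ?_⟩
    rw [← h.preimage_interior]
    exact hK.2.2.preimage h.surjective
  have h0 : (0 : E3) ∈ frontier (h ⁻¹' K) := by
    rw [hf]
    simpa [h] using hp
  obtain ⟨ε, hε, H⟩ := small_ball_at_zero _ hbody h0
  refine ⟨ε, hε, fun r hr hrε => ?_⟩
  obtain ⟨φ, hc, hi, hd, hb⟩ := H r hr hrε
  refine ⟨fun y => h (φ y), h.continuous.comp_continuousOn hc, h.injective.comp_injOn hi, ?_, ?_⟩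
  · rw [← Function.comp_def h φ, image_comp, hd, hf]
    ext x
    simp [h, ← sub_eq_add_neg, dist_eq_norm]
  · rw [← Function.comp_def h φ, image_comp, hb, hf]
    ext x
    simp [h, ← sub_eq_add_neg, dist_eq_norm]
end
end

section
/- Let K ⊆ ℝ³ be a convex body, let γ : (−1, 1) → ℝ³ be a continuously differentiable injective curve with γ'(t) ≠ 0 for all t and image contained in ∂K, let p := γ(0), and let L := {p + s·γ'(0) : s ∈ ℝ} be the tangent line of γ at p. Then the tangent cone T_pK := cl({p + t(x − p) : t ≥ 0, x ∈ K}) is a wedge containing L: either T_pK is a closed half-space whose boundary plane contains L, or there exist two closed half-spaces W₁ and W₂ with distinct, non-parallel boundary planes each containing L such that T_pK = W₁ ∩ W₂. Consequently, the frontier of T_pK consists of one or two half-planes bounded by L. -/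
open Set
open scoped RealInnerProductSpace

noncomputable section

/-- The outward normal vectors of `K` at `p`. -/
def normalVectors (K : Set E3) (p : E3) : Set E3 :=
  {u | ∀ x ∈ K, ⟪u, x - p⟫ ≤ 0}

lemma convex_cone_at {K : Set E3} (hK : Convex ℝ K) (p : E3) :
    Convex ℝ {y | ∃ t : ℝ, 0 ≤ t ∧ ∃ x ∈ K, y = p + t • (x - p)} := by
  rintro _ ⟨t, ht, x, hx, rfl⟩ _ ⟨t', ht', x', hx', rfl⟩ a b ha hb hab
  have h1 : 0 ≤ a * t := mul_nonneg ha ht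
  have h2 : 0 ≤ b * t' := mul_nonneg hb ht'
  obtain rfl : b = 1 - a := by linarith
  rcases (add_nonneg h1 h2).eq_or_lt with h | h
  · refine ⟨0, le_rfl, x, hx, ?_⟩
    have e1 : a * t = 0 := by linarith
    have e2 : (1 - a) * t' = 0 := by linarith
    calc _ = p + (a * t) • (x - p) + ((1 - a) * t') • (x' - p) := by module
      _ = _ := by rw [e1, e2]; module
  · refine ⟨a * t + (1 - a) * t', h.le, _, hK hx hx' (div_nonneg h1 h.le) (div_nonneg h2 h.le)
      (by rw [← add_div, div_self h.ne']), ?_⟩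
    match_scalars <;> field_simp
    ring

lemma tangent_cone_eq_polar {K : Set E3} (hK : Convex ℝ K) {p : E3} (hp : p ∈ K) :
    closure {y | ∃ t : ℝ, 0 ≤ t ∧ ∃ x ∈ K, y = p + t • (x - p)} =
      {y | ∀ u ∈ normalVectors K p, ⟪u, y - p⟫ ≤ 0} := by
  apply Subset.antisymm
  · refine closure_minimal ?_ ?_
    · rintro _ ⟨t, ht, x, hx, rfl⟩ u hu
      rw [add_sub_cancel_left, inner_smul_right]
      exact mul_nonpos_of_nonneg_of_nonpos ht (hu x hx)
    · simp only [ofPred_forall]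
      exact isClosed_iInter fun u => isClosed_iInter fun _ =>
        isClosed_le (by fun_prop) continuous_const
  · intro y hy
    by_contra hyT
    obtain ⟨f, c, hf, hfy⟩ := geometric_hahn_banach_closed_point
      (convex_cone_at hK p).closure isClosed_closure hyT
    obtain ⟨u, rfl⟩ := (InnerProductSpace.toDual ℝ E3).surjective f
    simp only [InnerProductSpace.toDual_apply_apply] at hf hfy
    have key : ∀ t : ℝ, 0 ≤ t → ∀ x ∈ K, ⟪u, p⟫ + t * ⟪u, x - p⟫ < c := by
      intro t ht x hx
      have := hf _ (subset_closure ⟨t, ht, x, hx, rfl⟩)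
      rwa [inner_add_right, inner_smul_right] at this
    have hu : u ∈ normalVectors K p := by
      intro x hx
      by_contra! hpos
      have h0 := key 0 le_rfl x hx
      have h1 := key ((c - ⟪u, p⟫) / ⟪u, x - p⟫) (div_nonneg (by linarith) hpos.le) x hx
      rw [div_mul_cancel₀ _ hpos.ne'] at h1
      linarith
    have h0 := key 0 le_rfl p hp
    have h1 := hy u hu
    rw [inner_sub_right] at h1
    linarith

lemma exists_normalVector_ne_zero {K : Set E3} (hK : Convex ℝ K) (hne : (interior K).Nonempty)
    {p : E3} (hp : p ∈ frontier K) : ∃ u ∈ normalVectors K p, u ≠ 0 := by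
  obtain ⟨f, hf⟩ := geometric_hahn_banach_open_point hK.interior isOpen_interior hp.2
  obtain ⟨u, rfl⟩ := (InnerProductSpace.toDual ℝ E3).surjective f
  simp only [InnerProductSpace.toDual_apply_apply] at hf
  refine ⟨u, ?_, ?_⟩
  · intro x hx
    have hx' : x ∈ closure (interior K) := by
      rw [hK.closure_interior_eq_closure_of_nonempty_interior hne]
      exact subset_closure hx
    have : closure (interior K) ⊆ {x | ⟪u, x⟫ ≤ ⟪u, p⟫} :=
      closure_minimal (fun z hz => (hf z hz).le) (isClosed_le (by fun_prop) continuous_const)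
    have := this hx'
    rw [inner_sub_right]
    exact sub_nonpos.2 this
  · rintro rfl
    obtain ⟨q, hq⟩ := hne
    simpa using hf q hq

lemma norm_normalVector_le {K : Set E3} {p q : E3} {r : ℝ} (hr : 0 < r)
    (hq : Metric.closedBall q r ⊆ K) {u : E3} (hu : u ∈ normalVectors K p) :
    r * ‖u‖ ≤ -⟪u, q - p⟫ := by
  rcases eq_or_ne u 0 with rfl | hu0
  · simp
  have hn : 0 < ‖u‖ := norm_pos_iff.2 hu0
  have hx : q + (r / ‖u‖) • u ∈ K := by
    apply hq
    rw [mem_closedBall_iff_norm, add_sub_cancel_left, norm_smul, Real.norm_eq_abs,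
      abs_of_pos (div_pos hr hn), div_mul_cancel₀ _ hn.ne']
  have h := hu _ hx
  rw [add_sub_right_comm, inner_add_right, inner_smul_right, real_inner_self_eq_norm_sq] at h
  have : r / ‖u‖ * ‖u‖ ^ 2 = r * ‖u‖ := by field_simp
  linarith

lemma exists_common_normal {v w : E3} (h : LinearIndependent ℝ ![v, w]) :
    ∃ e : E3, e ≠ 0 ∧ ∀ x, ⟪x, v⟫ = 0 → ⟪x, w⟫ = 0 → ∃ s : ℝ, x = s • e := by
  set P : Submodule ℝ E3 := Submodule.span ℝ (range ![v, w])
  have h2 : Module.finrank ℝ P = 2 := by simpa using finrank_span_eq_card h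
  have h3 := P.finrank_add_finrank_orthogonal
  rw [h2, finrank_euclideanSpace_fin] at h3
  obtain ⟨e, he, hspan⟩ := finrank_eq_one_iff'.1 (show Module.finrank ℝ Pᗮ = 1 by omega)
  refine ⟨e, by simpa using he, fun x hv hw => ?_⟩
  have hx : x ∈ Pᗮ := by
    have hP : P ≤ (Submodule.span ℝ {x})ᗮ := by
      refine Submodule.span_le.2 ?_
      rintro _ ⟨i, rfl⟩
      rw [SetLike.mem_coe, Submodule.mem_orthogonal_singleton_iff_inner_right]
      fin_cases i <;> simpa
    rw [Submodule.mem_orthogonal']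
    intro y hy
    exact Submodule.mem_orthogonal_singleton_iff_inner_right.1 (hP hy)
  obtain ⟨s, hs⟩ := hspan ⟨x, hx⟩
  exact ⟨s, by simpa using (congrArg Subtype.val hs).symm⟩

/-- If all outward normals of `K` at `p` are orthogonal to `v ≠ 0`, then two of them determine
the polar cone of all of them. -/
lemma exists_extreme_normalVectors {K : Set E3} (hK : Convex ℝ K)
    (hne : (interior K).Nonempty) {p : E3} (hp : p ∈ frontier K) {v : E3} (hv : v ≠ 0)
    (hvn : ∀ u ∈ normalVectors K p, ⟪u, v⟫ = 0) :
    ∃ q : E3, ∃ a ∈ normalVectors K p, ∃ b ∈ normalVectors K p,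
      ⟪a, q⟫ = -1 ∧ ⟪b, q⟫ = -1 ∧
      ∀ x : E3, ⟪a, x⟫ ≤ 0 → ⟪b, x⟫ ≤ 0 → ∀ u ∈ normalVectors K p, ⟪u, x⟫ ≤ 0 := by
  obtain ⟨q, hq⟩ := hne
  obtain ⟨r, hr, hball⟩ := Metric.nhds_basis_closedBall.mem_iff.1 (mem_interior_iff_mem_nhds.1 hq)
  have hbound : ∀ u ∈ normalVectors K p, r * ‖u‖ ≤ -⟪u, q - p⟫ :=
    fun u hu => norm_normalVector_le hr hball hu
  have hneg : ∀ u ∈ normalVectors K p, u ≠ 0 → ⟪u, q - p⟫ < 0 := by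
    intro u hu h0
    have := hbound u hu
    have := mul_pos hr (norm_pos_iff.2 h0)
    linarith
  have hsmul : ∀ u ∈ normalVectors K p, ∀ t : ℝ, 0 ≤ t → t • u ∈ normalVectors K p := by
    intro u hu t ht x hx
    rw [real_inner_smul_left]
    exact mul_nonpos_of_nonneg_of_nonpos ht (hu x hx)
  set S : Set E3 := {u | u ∈ normalVectors K p ∧ ⟪u, q - p⟫ = -1} with hS
  have hscale : ∀ u ∈ normalVectors K p, u ≠ 0 → (-⟪u, q - p⟫)⁻¹ • u ∈ S := by
    intro u hu h0
    have h := hneg u hu h0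
    refine ⟨hsmul u hu _ (inv_nonneg.2 (by linarith)), ?_⟩
    rw [real_inner_smul_left, inv_neg, neg_mul, inv_mul_cancel₀ h.ne]
  obtain ⟨u₀, hu₀, hu₀0⟩ := exists_normalVector_ne_zero hK ⟨q, hq⟩ hp
  have hSne : S.Nonempty := ⟨_, hscale u₀ hu₀ hu₀0⟩
  have hScl : IsClosed S := by
    refine IsClosed.inter (s₁ := normalVectors K p) ?_ (isClosed_eq (by fun_prop) continuous_const)
    simp only [normalVectors, ofPred_forall]
    exact isClosed_iInter fun x => isClosed_iInter fun _ =>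
      isClosed_le (by fun_prop) continuous_const
  have hScpt : IsCompact S := by
    refine (isCompact_closedBall (0 : E3) r⁻¹).of_isClosed_subset hScl ?_
    rintro u ⟨hu, hu1⟩
    have h := hbound u hu
    rw [hu1, neg_neg] at h
    rw [mem_closedBall_zero_iff, ← one_div, le_div_iff₀ hr]
    linarith
  have hli : LinearIndependent ℝ ![v, q - p] := by
    rw [LinearIndependent.pair_iff' hv]
    intro c hc
    have h := hneg u₀ hu₀ hu₀0
    rw [← hc, inner_smul_right, hvn u₀ hu₀, mul_zero] at h
    exact h.false
  obtain ⟨e, he, hspan⟩ := exists_common_normal hli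
  have hdiff : ∀ a ∈ S, ∀ u ∈ S, ∃ s : ℝ, u = a + s • e := by
    intro a ha u hu
    obtain ⟨s, hs⟩ := hspan (u - a)
      (by rw [inner_sub_left, hvn u hu.1, hvn a ha.1, sub_zero])
      (by rw [inner_sub_left, hu.2, ha.2, sub_self])
    exact ⟨s, by rw [← hs]; abel⟩
  have hcont : ContinuousOn (fun u : E3 => ⟪e, u⟫) S := by fun_prop
  obtain ⟨a, ha, hmin⟩ := hScpt.exists_isMinOn hSne hcont
  obtain ⟨b, hb, hmax⟩ := hScpt.exists_isMaxOn hSne hcont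
  refine ⟨q - p, a, ha.1, b, hb.1, ha.2, hb.2, fun x hax hbx u hu => ?_⟩
  rcases eq_or_ne u 0 with rfl | hu0
  · simp
  have hSx : ∀ w ∈ S, ⟪w, x⟫ ≤ 0 := by
    intro w hw
    have h1 : ⟪e, a⟫ ≤ ⟪e, w⟫ := hmin hw
    have h2 : ⟪e, w⟫ ≤ ⟪e, b⟫ := hmax hw
    obtain ⟨s, hs⟩ := hdiff a ha w hw
    obtain ⟨s', hs'⟩ := hdiff a ha b hb
    have hee : 0 < ⟪e, e⟫ := real_inner_self_pos.2 he
    rw [hs, inner_add_right, inner_smul_right] at h1 h2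
    rw [hs', inner_add_right, inner_smul_right] at h2
    rw [hs', inner_add_left, real_inner_smul_left] at hbx
    rw [hs, inner_add_left, real_inner_smul_left]
    have hs0 : 0 ≤ s := by
      by_contra! hlt
      nlinarith
    have hss' : s ≤ s' := by
      by_contra! hlt
      nlinarith
    rcases le_total ⟪e, x⟫ 0 with h | h <;> nlinarith
  have h := hSx _ (hscale u hu hu0)
  rw [real_inner_smul_left] at h
  by_contra! hpos
  have := mul_pos (inv_pos.2 (neg_pos.2 (hneg u hu hu0))) hpos
  linarith

lemma inner_normalize_le_iff {u : E3} (hu : u ≠ 0) (x p : E3) :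
    ⟪‖u‖⁻¹ • u, x⟫ ≤ ⟪‖u‖⁻¹ • u, p⟫ ↔ ⟪u, x - p⟫ ≤ 0 := by
  rw [real_inner_smul_left, real_inner_smul_left,
    mul_le_mul_iff_right₀ (inv_pos.2 (norm_pos_iff.2 hu)), inner_sub_right, sub_nonpos]

lemma norm_normalize {u : E3} (hu : u ≠ 0) : ‖‖u‖⁻¹ • u‖ = 1 := by
  rw [norm_smul, norm_inv, norm_norm, inv_mul_cancel₀ (norm_ne_zero_iff.2 hu)]

lemma inner_deriv_eq_zero_of_mem_normalVectors {K : Set E3} {γ : ℝ → E3} {v u : E3}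
    (hmem : ∀ t ∈ Ioo (-1 : ℝ) 1, γ t ∈ K) (hd : HasDerivAt γ v 0)
    (hu : u ∈ normalVectors K (γ 0)) : ⟪u, v⟫ = 0 := by
  have hder : HasDerivAt (fun t => ⟪u, γ t⟫) ⟪u, v⟫ 0 :=
    (innerSL ℝ u).hasFDerivAt.comp_hasDerivAt 0 hd
  refine IsLocalMax.hasDerivAt_eq_zero ?_ hder
  filter_upwards [Ioo_mem_nhds (by norm_num : (-1 : ℝ) < 0) one_pos] with t ht
  have := hu _ (hmem t ht)
  rwa [inner_sub_right, sub_nonpos] at this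

/-- **The tangent cone along a C¹ curve in a convex boundary is a wedge.**
If `γ` is a C¹ embedded curve in `∂K` through `p = γ(0)` with tangent line
`L`, then `T_pK` is either a closed half-space whose boundary plane contains
`L`, or the intersection of two closed half-spaces with non-parallel boundary
planes, each containing `L`. -/
theorem tangent_cone_is_wedge (K : Set E3) (hK : IsConvexBody K)
    (γ g1 : ℝ → E3)
    (hmem : ∀ t ∈ Ioo (-1 : ℝ) 1, γ t ∈ frontier K)
    (hd : ∀ t ∈ Ioo (-1 : ℝ) 1, HasDerivAt γ (g1 t) t)
    (hc : ContinuousOn g1 (Ioo (-1 : ℝ) 1))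
    (hreg : ∀ t ∈ Ioo (-1 : ℝ) 1, g1 t ≠ 0)
    (hinj : Set.InjOn γ (Ioo (-1 : ℝ) 1))
    (p : E3) (hpγ : p = γ 0)
    (L : Set E3) (hL : L = {x | ∃ s : ℝ, x = p + s • g1 0})
    (T : Set E3)
    (hT : T = closure {y | ∃ t : ℝ, 0 ≤ t ∧ ∃ x ∈ K, y = p + t • (x - p)}) :
    (∃ (u : E3) (a : ℝ), ‖u‖ = 1 ∧ T = {x | ⟪u, x⟫ ≤ a} ∧
      L ⊆ {x | ⟪u, x⟫ = a}) ∨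
    (∃ (u₁ : E3) (a₁ : ℝ) (u₂ : E3) (a₂ : ℝ), ‖u₁‖ = 1 ∧ ‖u₂‖ = 1 ∧
      (¬ ∃ s : ℝ, u₂ = s • u₁) ∧
      L ⊆ {x | ⟪u₁, x⟫ = a₁} ∧ L ⊆ {x | ⟪u₂, x⟫ = a₂} ∧
      T = {x | ⟪u₁, x⟫ ≤ a₁} ∩ {x | ⟪u₂, x⟫ ≤ a₂}) := by
  have h0 : (0 : ℝ) ∈ Ioo (-1 : ℝ) 1 := by norm_num
  have hcl : frontier K ⊆ K := hK.1.isClosed.frontier_subset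
  have hpf : p ∈ frontier K := hpγ ▸ hmem 0 h0
  have hvn : ∀ u ∈ normalVectors K p, ⟪u, g1 0⟫ = 0 := fun u hu =>
    inner_deriv_eq_zero_of_mem_normalVectors (fun t ht => hcl (hmem t ht)) (hd 0 h0) (hpγ ▸ hu)
  obtain ⟨q, a, ha, b, hb, haq, hbq, hab⟩ :=
    exists_extreme_normalVectors hK.2.1 hK.2.2 hpf (hreg 0 h0) hvn
  rw [tangent_cone_eq_polar hK.2.1 (hcl hpf)] at hT
  have hTab : T = {x | ⟪a, x - p⟫ ≤ 0 ∧ ⟪b, x - p⟫ ≤ 0} := by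
    rw [hT]
    ext x
    exact ⟨fun h => ⟨h a ha, h b hb⟩, fun h => hab _ h.1 h.2⟩
  have ha0 : a ≠ 0 := by rintro rfl; simp at haq
  have hb0 : b ≠ 0 := by rintro rfl; simp at hbq
  have hLu : ∀ u ∈ normalVectors K p, L ⊆ {x | ⟪‖u‖⁻¹ • u, x⟫ = ⟪‖u‖⁻¹ • u, p⟫} := by
    intro u hu
    rw [hL]
    rintro _ ⟨s, rfl⟩
    simp [inner_add_right, inner_smul_right, real_inner_smul_left, hvn u hu]
  by_cases h : a = b
  · subst h
    refine Or.inl ⟨‖a‖⁻¹ • a, ⟪‖a‖⁻¹ • a, p⟫, norm_normalize ha0, ?_, hLu a ha⟩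
    rw [hTab]
    ext x
    simp only [mem_ofPred_eq, inner_normalize_le_iff ha0, and_self]
  · refine Or.inr ⟨‖a‖⁻¹ • a, ⟪‖a‖⁻¹ • a, p⟫, ‖b‖⁻¹ • b, ⟪‖b‖⁻¹ • b, p⟫, norm_normalize ha0,
      norm_normalize hb0, ?_, hLu a ha, hLu b hb, ?_⟩
    · rintro ⟨s, hs⟩
      have hba : b = (‖b‖ * s * ‖a‖⁻¹) • a := by
        rw [mul_smul, mul_smul, ← hs, smul_inv_smul₀ (norm_ne_zero_iff.2 hb0)]
      have hc := hbq
      rw [hba, real_inner_smul_left, haq] at hc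
      rw [show ‖b‖ * s * ‖a‖⁻¹ = 1 by linarith, one_smul] at hba
      exact h hba.symm
    · rw [hTab]
      ext x
      simp only [mem_inter_iff, mem_ofPred_eq, inner_normalize_le_iff ha0,
        inner_normalize_le_iff hb0]
end
end
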